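/- Let μ_n = (1/n) Σ_{i=1}^n δ_{x_i} with x_1, …, x_n ∈ ℝ, and let μ̂_n = proj_{F_lc} μ_n. If μ_n is a point mass then μ̂_n = μ_n. Otherwise, μ̂_n has a compactly supported density f which is piecewise log-affine with finitely many pieces: the support of f is a compact interval that can be partitioned into finitely many subintervals on each of which log f is affine. -/

import Mathlib

open MeasureTheory Set Filter

noncomputable def quantile (μ : MeasureTheory.Measure ℝ) (u : ℝ) : ℝ :=
  sInf {x : ℝ | u ≤ (μ (Set.Iic x)).toReal}

def HasFiniteMomentP (p : ℝ) (μ : MeasureTheory.Measure ℝ) : Prop :=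
  MeasureTheory.IsProbabilityMeasure μ ∧
    MeasureTheory.Integrable (fun x => |x| ^ p) μ

noncomputable def Wdist (p : ℝ) (μ ν : MeasureTheory.Measure ℝ) : ℝ :=
  (∫ u in Set.Ioo (0:ℝ) 1, |quantile μ u - quantile ν u| ^ p) ^ (1 / p)

def DisplacementConvex (F : Set (MeasureTheory.Measure ℝ)) : Prop :=
  ∀ μ ∈ F, ∀ ν ∈ F, ∀ t ∈ Set.Icc (0:ℝ) 1, ∃ σ ∈ F,
    ∀ u ∈ Set.Ioo (0:ℝ) 1,
      quantile σ u = (1 - t) * quantile μ u + t * quantile ν u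

def WClosed (p : ℝ) (F : Set (MeasureTheory.Measure ℝ)) : Prop :=
  ∀ (μs : ℕ → MeasureTheory.Measure ℝ) (μ : MeasureTheory.Measure ℝ),
    (∀ n, μs n ∈ F) → HasFiniteMomentP p μ →
    Filter.Tendsto (fun n => Wdist p (μs n) μ) Filter.atTop (nhds 0) → μ ∈ F

/-- A Borel probability measure on `ℝ` is log-concave if it is a point mass, or it has a
density `f` with respect to Lebesgue measure such that `log f : ℝ → [−∞, ∞)` is concave;
the latter is expressed by the multiplicative inequality
`f((1−t)x + ty) ≥ f(x)^(1−t) · f(y)^t`. -/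
def IsLogConcave (μ : MeasureTheory.Measure ℝ) : Prop :=
  (∃ x : ℝ, μ = MeasureTheory.Measure.dirac x) ∨
  ∃ f : ℝ → ℝ, (∀ x, 0 ≤ f x) ∧
    μ = MeasureTheory.volume.withDensity (fun x => ENNReal.ofReal (f x)) ∧
    ∀ x y : ℝ, ∀ t ∈ Set.Icc (0:ℝ) 1,
      f x ^ (1 - t) * f y ^ t ≤ f ((1 - t) * x + t * y)

/-- The set `F_lc` of log-concave probability measures on `ℝ`. -/
def Flc : Set (MeasureTheory.Measure ℝ) :=
  {μ | MeasureTheory.IsProbabilityMeasure μ ∧ IsLogConcave μ}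

/-- The Galois connection between the quantile function and the distribution function. -/
lemma quantile_le_iff (ν : Measure ℝ) [IsProbabilityMeasure ν] {u x : ℝ} (hu : u ∈ Ioo (0 : ℝ) 1) :
    quantile ν u ≤ x ↔ u ≤ ν.real (Iic x) := by
  have hset : {x : ℝ | u ≤ (ν (Iic x)).toReal} = {x : ℝ | u ≤ ProbabilityTheory.cdf ν x} := by
    ext y
    simp [ProbabilityTheory.cdf_eq_real, Measure.real]
  have hmono := ProbabilityTheory.monotone_cdf ν
  have hne : {x : ℝ | u ≤ ProbabilityTheory.cdf ν x}.Nonempty := by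
    obtain ⟨y, hy⟩ := ((ProbabilityTheory.tendsto_cdf_atTop ν).eventually_const_lt hu.2).exists
    exact ⟨y, hy.le⟩
  have hbdd : BddBelow {x : ℝ | u ≤ ProbabilityTheory.cdf ν x} := by
    obtain ⟨y, hy⟩ := ((ProbabilityTheory.tendsto_cdf_atBot ν).eventually_lt_const hu.1).exists
    refine ⟨y, fun z hz => ?_⟩
    by_contra! h
    exact absurd (hmono h.le) (not_le.2 (hy.trans_le hz))
  rw [← ProbabilityTheory.cdf_eq_real, quantile, hset]
  refine ⟨fun h => ?_, fun h => csInf_le hbdd h⟩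
  have hinf : u ≤ ProbabilityTheory.cdf ν (sInf {x : ℝ | u ≤ ProbabilityTheory.cdf ν x}) := by
    set q := sInf {x : ℝ | u ≤ ProbabilityTheory.cdf ν x}
    have hr := ((ProbabilityTheory.cdf ν).right_continuous q).mono Ioi_subset_Ici_self
    refine ge_of_tendsto hr ?_
    filter_upwards [self_mem_nhdsWithin] with y hy
    obtain ⟨z, hz, hzy⟩ := exists_lt_of_csInf_lt hne hy
    exact le_trans hz (hmono hzy.le)
  exact hinf.trans (hmono h)

lemma quantile_monotoneOn (ν : Measure ℝ) [IsProbabilityMeasure ν] :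
    MonotoneOn (quantile ν) (Ioo 0 1) := fun _ hu _ hv huv =>
  (quantile_le_iff ν hu).2 (huv.trans ((quantile_le_iff ν hv).1 le_rfl))

lemma quantile_aemeasurable (ν : Measure ℝ) [IsProbabilityMeasure ν] :
    AEMeasurable (quantile ν) (volume.restrict (Ioo 0 1)) :=
  aemeasurable_restrict_of_monotoneOn measurableSet_Ioo (quantile_monotoneOn ν)

instance isProbabilityMeasure_restrict_Ioo :
    IsProbabilityMeasure (volume.restrict (Ioo (0 : ℝ) 1)) := ⟨by simp⟩

lemma map_quantile (ν : Measure ℝ) [IsProbabilityMeasure ν] :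
    (volume.restrict (Ioo (0 : ℝ) 1)).map (quantile ν) = ν := by
  have := Measure.isProbabilityMeasure_map (quantile_aemeasurable ν)
  refine Measure.ext_of_Iic _ _ fun x => ?_
  rw [Measure.map_apply_of_aemeasurable (quantile_aemeasurable ν) measurableSet_Iic,
    Measure.restrict_apply' measurableSet_Ioo]
  have h1 : quantile ν ⁻¹' Iic x ∩ Ioo 0 1 = Iic (ν.real (Iic x)) ∩ Ioo 0 1 := by
    ext u
    constructor
    · rintro ⟨h, hu⟩
      exact ⟨(quantile_le_iff ν hu).1 h, hu⟩
    · rintro ⟨h, hu⟩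
      exact ⟨(quantile_le_iff ν hu).2 h, hu⟩
  have h0 : ν.real (Iic x) ≤ 1 := measureReal_le_one
  have h2 : (Iic (ν.real (Iic x)) ∩ Ioo (0 : ℝ) 1 : Set ℝ) =ᵐ[volume] Ioc 0 (ν.real (Iic x)) := by
    have hne : ∀ᵐ u : ℝ, u ≠ 1 := by simp [ae_iff]
    filter_upwards [hne] with u hu
    refine propext ⟨fun h => ⟨h.2.1, h.1⟩, fun h => ⟨h.2, h.1, ?_⟩⟩
    exact lt_of_le_of_ne (h.2.trans h0) hu
  rw [h1, measure_congr h2, Real.volume_Ioc, sub_zero, ofReal_measureReal]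

lemma integral_quantile (ν : Measure ℝ) [IsProbabilityMeasure ν] {g : ℝ → ℝ}
    (hg : Continuous g) : ∫ u in Ioo (0 : ℝ) 1, g (quantile ν u) = ∫ x, g x ∂ν := by
  conv_rhs => rw [← map_quantile ν]
  rw [integral_map (quantile_aemeasurable ν) hg.aestronglyMeasurable]

lemma integrable_quantile (ν : Measure ℝ) [IsProbabilityMeasure ν] {g : ℝ → ℝ}
    (hg : Continuous g) (hi : Integrable g ν) :
    IntegrableOn (fun u => g (quantile ν u)) (Ioo 0 1) := by
  rw [← map_quantile ν] at hi
  exact (integrable_map_measure hg.aestronglyMeasurable (quantile_aemeasurable ν)).1 hi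

/-- Without atoms, the distribution function inverts the quantile function. -/
lemma measureReal_Iic_quantile (ν : Measure ℝ) [IsProbabilityMeasure ν] [NullSingletonClass ν]
    {u : ℝ} (hu : u ∈ Ioo (0 : ℝ) 1) : ν.real (Iic (quantile ν u)) = u := by
  refine le_antisymm ?_ ((quantile_le_iff ν hu).1 le_rfl)
  have h1 : ν (Iic (quantile ν u)) = ν (Iio (quantile ν u)) := measure_congr Iio_ae_eq_Iic.symm
  have h2 : ν (Iio (quantile ν u)) ≤ ENNReal.ofReal u := by
    obtain ⟨s, hs, hslt, hst⟩ := exists_seq_strictMono_tendsto (quantile ν u)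
    have hU : Iio (quantile ν u) = ⋃ n, Iic (s n) := by
      ext y
      simp only [mem_Iio, mem_iUnion, mem_Iic]
      constructor
      · intro hy
        obtain ⟨n, hn⟩ := (hst.eventually_const_lt hy).exists
        exact ⟨n, hn.le⟩
      · rintro ⟨n, hn⟩
        exact hn.trans_lt (hslt n)
    have hm : Monotone fun n => Iic (s n) := fun i j hij => Iic_subset_Iic.2 (hs.monotone hij)
    rw [hU, hm.measure_iUnion]
    refine iSup_le fun n => ?_
    rw [← ofReal_measureReal]
    refine ENNReal.ofReal_le_ofReal ?_
    by_contra! h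
    exact absurd ((quantile_le_iff ν hu).2 h.le) (not_le.2 (hslt n))
  rw [measureReal_def, h1]
  exact ENNReal.toReal_le_of_le_ofReal hu.1.le h2

lemma isProbabilityMeasure_empirical {n : ℕ} (hn : 0 < n) (x : ℕ → ℝ) :
    IsProbabilityMeasure ((n : ENNReal)⁻¹ • ∑ i ∈ Finset.range n, Measure.dirac (x i)) := by
  constructor
  simp only [Measure.smul_apply, Measure.finsetSum_apply, measure_univ, Finset.sum_const,
    Finset.card_range, nsmul_eq_mul, mul_one, smul_eq_mul]
  exact ENNReal.inv_mul_cancel (by exact_mod_cast hn.ne') (ENNReal.natCast_ne_top n)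

/-- The quantile function of an atomic measure takes its values among the atoms. -/
lemma quantile_mem_of_measure_compl_eq_zero (ν : Measure ℝ) [IsProbabilityMeasure ν] {X : Set ℝ}
    (hX : IsClosed X) (hν : ν Xᶜ = 0) {u : ℝ} (hu : u ∈ Ioo (0 : ℝ) 1) : quantile ν u ∈ X := by
  by_contra h
  obtain ⟨δ, hδ, hball⟩ := Metric.isOpen_iff.1 hX.isOpen_compl _ h
  have hle : quantile ν u ≤ quantile ν u - δ / 2 := by
    rw [quantile_le_iff ν hu]
    refine ((quantile_le_iff ν hu).1 le_rfl).trans ?_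
    have hsplit : Iic (quantile ν u) ⊆ Iic (quantile ν u - δ / 2) ∪ Xᶜ := by
      intro y hy
      rcases le_or_gt y (quantile ν u - δ / 2) with h1 | h1
      · exact Or.inl h1
      · refine Or.inr (hball ?_)
        rw [Metric.mem_ball, Real.dist_eq, abs_lt]
        constructor <;> linarith [mem_Iic.1 hy]
    calc ν.real (Iic (quantile ν u))
        ≤ ν.real (Iic (quantile ν u - δ / 2) ∪ Xᶜ) := measureReal_mono hsplit
      _ ≤ ν.real (Iic (quantile ν u - δ / 2)) + ν.real Xᶜ := measureReal_union_le _ _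
      _ = ν.real (Iic (quantile ν u - δ / 2)) := by simp [measureReal_def, hν]
  linarith

lemma exists_monotone_eq_quantile_empirical {n : ℕ} (hn : 0 < n) (x : ℕ → ℝ) :
    ∃ q : ℝ → ℝ, Monotone q ∧ (range q).Finite ∧ ∀ u ∈ Ioo (0 : ℝ) 1,
      quantile ((n : ENNReal)⁻¹ • ∑ i ∈ Finset.range n, Measure.dirac (x i)) u = q u := by
  have := isProbabilityMeasure_empirical hn x
  set κ := (n : ENNReal)⁻¹ • ∑ i ∈ Finset.range n, Measure.dirac (x i) with hκ
  set X : Set ℝ := x '' (Finset.range n : Set ℕ) with hXdef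
  have hX : X.Finite := (Finset.finite_toSet _).image x
  have hnull : κ Xᶜ = 0 := by
    simp only [hκ, Measure.smul_apply, Measure.finsetSum_apply, smul_eq_mul]
    rw [Finset.sum_eq_zero, mul_zero]
    intro i hi
    rw [Measure.dirac_apply' _ hX.measurableSet.compl]
    simp only [indicator_apply_eq_zero, mem_compl_iff]
    exact fun h => absurd (mem_image_of_mem x (by simpa using hi)) h
  have hmem : ∀ u ∈ Ioo (0 : ℝ) 1, quantile κ u ∈ X := fun u hu =>
    quantile_mem_of_measure_compl_eq_zero κ hX.isClosed hnull hu
  obtain ⟨m, hm⟩ := hX.bddBelow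
  obtain ⟨M, hM⟩ := hX.bddAbove
  have hmM : m ≤ M := (hm (hmem (1 / 2) (by norm_num))).trans (hM (hmem (1 / 2) (by norm_num)))
  refine ⟨fun u => if u ≤ 0 then m else if u < 1 then quantile κ u else M, ?_, ?_, ?_⟩
  · intro u v huv
    dsimp only
    split_ifs with h1 h2 h3 h4 h5 h6
    · exact le_rfl
    · exact hm (hmem v ⟨by linarith, by linarith⟩)
    · exact hmM
    · linarith
    · exact quantile_monotoneOn κ ⟨by linarith, by linarith⟩ ⟨by linarith, by linarith⟩ huv
    · exact hM (hmem u ⟨by linarith, by linarith⟩)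
    · linarith
    · linarith
    · exact le_rfl
  · refine ((hX.insert M).insert m).subset ?_
    rintro _ ⟨u, rfl⟩
    dsimp only
    split_ifs with h1 h2
    · simp
    · exact Or.inr (Or.inr (hmem u ⟨by linarith, by linarith⟩))
    · simp
  · intro u hu
    simp [not_le.2 hu.1, hu.2]

lemma Wdist_two_le_iff (μ ν κ : Measure ℝ) : Wdist 2 μ κ ≤ Wdist 2 ν κ ↔
    ∫ u in Ioo (0 : ℝ) 1, (quantile μ u - quantile κ u) ^ 2 ≤
      ∫ u in Ioo (0 : ℝ) 1, (quantile ν u - quantile κ u) ^ 2 := by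
  simp only [Wdist, Real.rpow_two, sq_abs]
  exact Real.rpow_le_rpow_iff (integral_nonneg fun _ => sq_nonneg _)
    (integral_nonneg fun _ => sq_nonneg _) (by norm_num)

/-- The Kantorovich potential, normalized to vanish at `x₀`, of the transport of `ν` to a measure
with quantile function `q`. -/
noncomputable def potential (q : ℝ → ℝ) (ν : Measure ℝ) (x₀ x : ℝ) : ℝ :=
  ∫ y in x₀..x, (y - q (ν.real (Iic y)))

section potential

variable {q : ℝ → ℝ}

lemma monotone_comp_measureReal_Iic (hq : Monotone q) (ν : Measure ℝ) [IsProbabilityMeasure ν] :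
    Monotone fun y => q (ν.real (Iic y)) := fun _ _ h =>
  hq (measureReal_mono (Iic_subset_Iic.2 h))

lemma intervalIntegrable_potential (hq : Monotone q) (ν : Measure ℝ) [IsProbabilityMeasure ν]
    (a b : ℝ) : IntervalIntegrable (fun y => y - q (ν.real (Iic y))) volume a b :=
  intervalIntegral.intervalIntegrable_id.sub
    (monotone_comp_measureReal_Iic hq ν).intervalIntegrable

lemma continuous_potential (hq : Monotone q) (ν : Measure ℝ) [IsProbabilityMeasure ν] (x₀ : ℝ) :
    Continuous (potential q ν x₀) :=
  intervalIntegral.continuous_primitive (intervalIntegrable_potential hq ν) x₀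

lemma potential_sub (hq : Monotone q) (ν : Measure ℝ) [IsProbabilityMeasure ν] (x₀ a b : ℝ) :
    potential q ν x₀ b - potential q ν x₀ a = ∫ y in a..b, (y - q (ν.real (Iic y))) :=
  intervalIntegral.integral_interval_sub_left (intervalIntegrable_potential hq ν _ _)
    (intervalIntegrable_potential hq ν _ _)

lemma abs_potential_le {M : ℝ} (hM : ∀ u, |q u| ≤ M) (ν : Measure ℝ) (x₀ x : ℝ) :
    |potential q ν x₀ x| ≤ (1 + |x₀| + M) ^ 2 * (1 + |x|) ^ 2 := by
  have hM0 : 0 ≤ M := (abs_nonneg _).trans (hM 0)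
  have h1 : ‖potential q ν x₀ x‖ ≤ (|x| + |x₀| + M) * |x - x₀| := by
    refine intervalIntegral.norm_integral_le_of_norm_le_const fun y hy => ?_
    have hy' : |y| ≤ |x| + |x₀| := by
      rcases le_total x₀ x with h | h
      · rw [uIoc_of_le h] at hy
        rw [abs_le]
        constructor <;> cases abs_cases x <;> cases abs_cases x₀ <;> linarith [hy.1, hy.2]
      · rw [uIoc_of_ge h] at hy
        rw [abs_le]
        constructor <;> cases abs_cases x <;> cases abs_cases x₀ <;> linarith [hy.1, hy.2]
    rw [Real.norm_eq_abs]
    linarith [abs_sub y (q (ν.real (Iic y))), hM (ν.real (Iic y))]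
  rw [Real.norm_eq_abs] at h1
  have hx := abs_nonneg x
  have hx0 := abs_nonneg x₀
  have h3 : |x| + |x₀| + M ≤ (1 + |x₀| + M) * (1 + |x|) := by nlinarith [mul_nonneg hx hx0]
  calc |potential q ν x₀ x| ≤ (|x| + |x₀| + M) * |x - x₀| := h1
    _ ≤ ((1 + |x₀| + M) * (1 + |x|)) * ((1 + |x₀| + M) * (1 + |x|)) := by
        refine mul_le_mul h3 ?_ (abs_nonneg _) (by positivity)
        linarith [abs_sub x x₀]
    _ = _ := by ring

lemma le_potential_sub (hq : Monotone q) (ν : Measure ℝ) [IsProbabilityMeasure ν] (x₀ a b : ℝ) :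
    (b - q (ν.real (Iic b))) * (b - a) - (b - a) ^ 2 / 2 ≤
      potential q ν x₀ b - potential q ν x₀ a := by
  rw [potential_sub hq]
  have hc : ∀ c d : ℝ, IntervalIntegrable (fun y => y - q (ν.real (Iic b))) volume c d :=
    fun c d => intervalIntegral.intervalIntegrable_id.sub intervalIntegrable_const
  have hval : ∀ c d : ℝ, ∫ y in c..d, (y - q (ν.real (Iic b))) =
      (d ^ 2 - c ^ 2) / 2 - (d - c) * q (ν.real (Iic b)) := by
    intro c d
    rw [intervalIntegral.integral_sub intervalIntegral.intervalIntegrable_id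
      intervalIntegrable_const]
    simp
  have hmono := monotone_comp_measureReal_Iic hq ν
  rcases le_total a b with h | h
  · have := intervalIntegral.integral_mono_on h (hc a b) (intervalIntegrable_potential hq ν a b)
      fun y hy => sub_le_sub_left (hmono hy.2) y
    rw [hval] at this
    linarith
  · have := intervalIntegral.integral_mono_on h (intervalIntegrable_potential hq ν b a) (hc b a)
      fun y hy => sub_le_sub_left (hmono hy.1) y
    rw [hval] at this
    rw [intervalIntegral.integral_symm]
    linarith

lemma integrable_of_abs_le_sq {ν : Measure ℝ} (hν : Integrable (fun x => (1 + |x|) ^ 2) ν)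
    {g : ℝ → ℝ} (hg : Continuous g) {C : ℝ} (h : ∀ x, |g x| ≤ C * (1 + |x|) ^ 2) :
    Integrable g ν :=
  (hν.const_mul C).mono' hg.aestronglyMeasurable (Eventually.of_forall h)

lemma integrable_potential (hq : Monotone q) {M : ℝ} (hM : ∀ u, |q u| ≤ M) (ν σ : Measure ℝ)
    [IsProbabilityMeasure ν] (hσ : Integrable (fun x => (1 + |x|) ^ 2) σ) (x₀ : ℝ) :
    Integrable (potential q ν x₀) σ :=
  integrable_of_abs_le_sq hσ (continuous_potential hq ν x₀) (abs_potential_le hM ν x₀)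

lemma integrableOn_quantile_sub_sq (hq : Monotone q) {M : ℝ} (hM : ∀ u, |q u| ≤ M)
    (ν : Measure ℝ) [IsProbabilityMeasure ν] (hν : Integrable (fun x => (1 + |x|) ^ 2) ν) :
    IntegrableOn (fun u => (quantile ν u - q u) ^ 2) (Ioo 0 1) := by
  have h1 := integrable_quantile ν (g := fun x => (1 + |x|) ^ 2) (by fun_prop) hν
  refine (h1.const_mul ((1 + M) ^ 2)).mono' ?_ (Eventually.of_forall fun u => ?_)
  · exact (((quantile_aemeasurable ν).sub hq.measurable.aemeasurable).pow_const 2)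
      |>.aestronglyMeasurable
  · rw [Real.norm_eq_abs, abs_pow, ← mul_pow]
    refine pow_le_pow_left₀ (abs_nonneg _) ?_ 2
    have := abs_sub (quantile ν u) (q u)
    have h2 := hM u
    nlinarith [abs_nonneg (quantile ν u), mul_nonneg (abs_nonneg (quantile ν u))
      ((abs_nonneg _).trans h2)]

/-- Kantorovich duality: the potential of `ν` bounds the increment of the squared distance. -/
lemma integral_quantile_sub_le (hq : Monotone q) {M : ℝ} (hM : ∀ u, |q u| ≤ M)
    (μ ν : Measure ℝ) [IsProbabilityMeasure μ] [IsProbabilityMeasure ν] [NullSingletonClass ν]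
    (hμ : Integrable (fun x => (1 + |x|) ^ 2) μ) (hν : Integrable (fun x => (1 + |x|) ^ 2) ν)
    (x₀ : ℝ) :
    (∫ u in Ioo (0 : ℝ) 1, (quantile ν u - q u) ^ 2) -
        ∫ u in Ioo (0 : ℝ) 1, (quantile μ u - q u) ^ 2 ≤
      2 * ((∫ x, potential q ν x₀ x ∂ν) - ∫ x, potential q ν x₀ x ∂μ) := by
  have hR := continuous_potential hq ν x₀
  have hRμ := integrable_potential hq hM ν μ hμ x₀
  have hRν := integrable_potential hq hM ν ν hν x₀
  have i1 := integrableOn_quantile_sub_sq hq hM ν hν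
  have i2 := integrableOn_quantile_sub_sq hq hM μ hμ
  have i3 := integrable_quantile ν hR hRν
  have i4 := integrable_quantile μ hR hRμ
  rw [← integral_quantile ν hR, ← integral_quantile μ hR, ← integral_sub i1 i2,
    ← integral_sub i3 i4, ← integral_const_mul]
  refine setIntegral_mono_on (i1.sub i2) ((i3.sub i4).const_mul 2) measurableSet_Ioo
    fun u hu => ?_
  have h := le_potential_sub hq ν x₀ (quantile μ u) (quantile ν u)
  rw [measureReal_Iic_quantile ν hu] at h
  nlinarith [h]

end potential

/-- The function equal to `exp ∘ φ` on `S` and to `0` elsewhere. -/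
noncomputable def logDensity (S : Set ℝ) (φ : ℝ → ℝ) : ℝ → ℝ :=
  S.indicator fun x => Real.exp (φ x)

section logDensity

variable {S : Set ℝ} {φ : ℝ → ℝ}

lemma logDensity_of_mem {x : ℝ} (hx : x ∈ S) : logDensity S φ x = Real.exp (φ x) :=
  indicator_of_mem hx _

lemma logDensity_of_notMem {x : ℝ} (hx : x ∉ S) : logDensity S φ x = 0 :=
  indicator_of_notMem hx _

lemma logDensity_nonneg (x : ℝ) : 0 ≤ logDensity S φ x :=
  indicator_nonneg (fun _ _ => (Real.exp_pos _).le) x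

lemma measurable_indicator_of_continuousOn (hS : MeasurableSet S) {g : ℝ → ℝ}
    (hg : ContinuousOn g S) : Measurable (S.indicator g) := by
  classical
  rw [← piecewise_eq_indicator]
  exact hg.measurable_piecewise continuousOn_const hS

lemma measurable_logDensity (hS : IsOpen S) (hφ : ConcaveOn ℝ S φ) :
    Measurable (logDensity S φ) :=
  measurable_indicator_of_continuousOn hS.measurableSet
    (Real.continuous_exp.comp_continuousOn (hφ.continuousOn hS))

lemma logDensity_rpow_mul_rpow_le (hφ : ConcaveOn ℝ S φ) (x y : ℝ) {t : ℝ}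
    (ht : t ∈ Icc (0 : ℝ) 1) : logDensity S φ x ^ (1 - t) * logDensity S φ y ^ t ≤
      logDensity S φ ((1 - t) * x + t * y) := by
  rcases eq_or_lt_of_le ht.1 with rfl | h0
  · simp
  rcases eq_or_lt_of_le ht.2 with rfl | h1
  · simp
  by_cases hx : x ∈ S
  · by_cases hy : y ∈ S
    · have hmem : (1 - t) * x + t * y ∈ S := by
        have := hφ.1 hx hy (sub_nonneg.2 ht.2) ht.1 (by ring)
        simpa only [smul_eq_mul] using this
      have hle := hφ.2 hx hy (sub_nonneg.2 ht.2) ht.1 (by ring)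
      simp only [smul_eq_mul] at hle
      rw [logDensity_of_mem hx, logDensity_of_mem hy, logDensity_of_mem hmem, ← Real.exp_mul,
        ← Real.exp_mul, ← Real.exp_add]
      exact Real.exp_le_exp.2 (by linarith)
    · rw [logDensity_of_notMem hy, Real.zero_rpow h0.ne', mul_zero]
      exact logDensity_nonneg _
  · rw [logDensity_of_notMem hx, Real.zero_rpow (sub_pos.2 h1).ne', zero_mul]
    exact logDensity_nonneg _

/-- The measure with density `logDensity S φ`. -/
noncomputable def logMeasure (S : Set ℝ) (φ : ℝ → ℝ) : Measure ℝ :=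
  volume.withDensity fun x => ENNReal.ofReal (logDensity S φ x)

lemma logMeasure_mem_Flc (hφ : ConcaveOn ℝ S φ) [h : IsProbabilityMeasure (logMeasure S φ)] :
    logMeasure S φ ∈ Flc :=
  ⟨h, Or.inr ⟨logDensity S φ, logDensity_nonneg, rfl, fun x y _ ht =>
    logDensity_rpow_mul_rpow_le hφ x y ht⟩⟩

instance nullSingletonClass_logMeasure : NullSingletonClass (logMeasure S φ) :=
  ⟨fun x => withDensity_absolutelyContinuous _ _ (measure_singleton x)⟩

lemma integrable_logDensity (hS : IsOpen S) (hφ : ConcaveOn ℝ S φ)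
    [IsFiniteMeasure (logMeasure S φ)] : Integrable (logDensity S φ) := by
  refine ⟨(measurable_logDensity hS hφ).aestronglyMeasurable, ?_⟩
  rw [hasFiniteIntegral_iff_ofReal (Eventually.of_forall logDensity_nonneg)]
  have := measure_lt_top (logMeasure S φ) univ
  rwa [logMeasure, withDensity_apply _ MeasurableSet.univ, Measure.restrict_univ] at this

lemma integral_logMeasure (hS : IsOpen S) (hφ : ConcaveOn ℝ S φ) (g : ℝ → ℝ) :
    ∫ x, g x ∂logMeasure S φ = ∫ x, logDensity S φ x * g x := by
  rw [logMeasure, integral_withDensity_eq_integral_toReal_smul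
    (measurable_logDensity hS hφ).ennreal_ofReal (by simp)]
  simp [ENNReal.toReal_ofReal, logDensity_nonneg]

lemma integrable_logMeasure_iff (hS : IsOpen S) (hφ : ConcaveOn ℝ S φ) (g : ℝ → ℝ) :
    Integrable g (logMeasure S φ) ↔ Integrable fun x => logDensity S φ x * g x := by
  rw [logMeasure, integrable_withDensity_iff_integrable_smul'
    (measurable_logDensity hS hφ).ennreal_ofReal (by simp)]
  simp [ENNReal.toReal_ofReal, logDensity_nonneg]

lemma isProbabilityMeasure_logMeasure (hi : Integrable (logDensity S φ))
    (h1 : ∫ x, logDensity S φ x = 1) : IsProbabilityMeasure (logMeasure S φ) := by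
  constructor
  rw [logMeasure, withDensity_apply _ MeasurableSet.univ, Measure.restrict_univ,
    ← ofReal_integral_eq_lintegral_ofReal hi (Eventually.of_forall logDensity_nonneg), h1,
    ENNReal.ofReal_one]

lemma integral_logDensity (hS : IsOpen S) (hφ : ConcaveOn ℝ S φ)
    [IsProbabilityMeasure (logMeasure S φ)] : ∫ x, logDensity S φ x = 1 := by
  have := integral_logMeasure hS hφ (fun _ => 1)
  simpa using this.symm

lemma measureReal_logMeasure (hS : IsOpen S) (hφ : ConcaveOn ℝ S φ)
    [IsFiniteMeasure (logMeasure S φ)] {A : Set ℝ} (hA : MeasurableSet A) :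
    (logMeasure S φ).real A = ∫ x in A, logDensity S φ x := by
  rw [measureReal_def, logMeasure, withDensity_apply _ hA,
    ← ofReal_integral_eq_lintegral_ofReal (integrable_logDensity hS hφ).integrableOn
      (Eventually.of_forall logDensity_nonneg), ENNReal.toReal_ofReal]
  exact integral_nonneg logDensity_nonneg

lemma nonempty_of_isProbabilityMeasure [IsProbabilityMeasure (logMeasure S φ)] : S.Nonempty := by
  by_contra! h
  have h0 : (logMeasure S φ) univ = 0 := by simp [logMeasure, logDensity, h]
  simp at h0

lemma exists_eq_logMeasure {μ : Measure ℝ} (hμ : μ ∈ Flc) (hd : ∀ c, μ ≠ Measure.dirac c) :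
    ∃ S φ, IsOpen S ∧ ConcaveOn ℝ S φ ∧ μ = logMeasure S φ := by
  obtain ⟨-, ⟨c, hc⟩ | ⟨g, hg0, hgμ, hg⟩⟩ := hμ
  · exact absurd hc (hd c)
  have hmid : ∀ ⦃x⦄, 0 < g x → ∀ ⦃y⦄, 0 < g y → ∀ ⦃a b : ℝ⦄, 0 ≤ a → 0 ≤ b → a + b = 1 →
      g x ^ a * g y ^ b ≤ g (a * x + b * y) := by
    intro x _ y _ a b ha hb hab
    obtain rfl : a = 1 - b := by linarith
    exact hg x y b ⟨hb, by linarith⟩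
  have hconv : Convex ℝ {x | 0 < g x} := by
    intro x hx y hy a b ha hb hab
    exact lt_of_lt_of_le (mul_pos (Real.rpow_pos_of_pos hx _) (Real.rpow_pos_of_pos hy _))
      (hmid hx hy ha hb hab)
  have hconc : ConcaveOn ℝ {x | 0 < g x} fun x => Real.log (g x) := by
    refine ⟨hconv, fun x hx y hy a b ha hb hab => ?_⟩
    have hx' := Real.rpow_pos_of_pos hx a
    have hy' := Real.rpow_pos_of_pos hy b
    have h := Real.log_le_log (mul_pos hx' hy') (hmid hx hy ha hb hab)
    rwa [Real.log_mul hx'.ne' hy'.ne', Real.log_rpow hx, Real.log_rpow hy] at h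
  refine ⟨interior {x | 0 < g x}, fun x => Real.log (g x), isOpen_interior,
    hconc.subset interior_subset hconv.interior, ?_⟩
  rw [hgμ, logMeasure]
  refine withDensity_congr_ae ?_
  have hnull : ∀ᵐ x, x ∉ frontier {x | 0 < g x} :=
    measure_eq_zero_iff_ae_notMem.1 (hconv.addHaar_frontier volume)
  filter_upwards [hnull] with x hx
  by_cases h : x ∈ interior {x | 0 < g x}
  · have h1 : x ∈ {x | 0 < g x} := interior_subset h
    rw [logDensity_of_mem h, Real.exp_log h1]
  · rw [logDensity_of_notMem h]
    have h1 : ¬ 0 < g x := fun h1 => hx ⟨subset_closure h1, h⟩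
    rw [le_antisymm (not_lt.1 h1) (hg0 x)]

end logDensity

lemma ConcaveOn.exists_supergradient {S : Set ℝ} {φ : ℝ → ℝ} (hS : IsOpen S)
    (hφ : ConcaveOn ℝ S φ) {x : ℝ} (hx : x ∈ S) :
    ∃ m, ∀ y ∈ S, φ y ≤ φ x + m * (y - x) := by
  have hf := hφ.neg
  have hxi : x ∈ interior S := by rwa [hS.interior_eq]
  refine ⟨-derivWithin (-φ) (Ioi x) x, fun y hy => ?_⟩
  rcases lt_trichotomy x y with h | rfl | h
  · have h1 := hf.rightDeriv_le_slope_of_mem_interior hxi hy h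
    rw [slope_def_field, le_div_iff₀ (sub_pos.2 h)] at h1
    simp only [Pi.neg_apply] at h1
    linarith
  · simp
  · have h1 := (hf.slope_le_leftDeriv_of_mem_interior hy hxi h).trans
      (hf.leftDeriv_le_rightDeriv_of_mem_interior hxi)
    rw [slope_def_field, div_le_iff₀ (sub_pos.2 h)] at h1
    simp only [Pi.neg_apply] at h1
    linarith

lemma logDensity_neg (S : Set ℝ) (φ : ℝ → ℝ) (x : ℝ) :
    logDensity (Neg.neg ⁻¹' S) (fun x => φ (-x)) x = logDensity S φ (-x) :=
  rfl

lemma ConcaveOn.comp_neg_real {S : Set ℝ} {φ : ℝ → ℝ} (hφ : ConcaveOn ℝ S φ) :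
    ConcaveOn ℝ (Neg.neg ⁻¹' S) fun x => φ (-x) := by
  have := hφ.comp_linearMap (-LinearMap.id : ℝ →ₗ[ℝ] ℝ)
  exact this

/-- An integrable log-concave function has an exponentially decaying right tail. -/
lemma exists_logDensity_le_exp_sub {S : Set ℝ} {φ : ℝ → ℝ} (hS : IsOpen S)
    (hφ : ConcaveOn ℝ S φ) (hi : Integrable (logDensity S φ)) :
    ∃ a b : ℝ, 0 < b ∧ ∀ x, logDensity S φ x ≤ Real.exp (a - b * x) := by
  rcases S.eq_empty_or_nonempty with rfl | ⟨x₀, hx₀⟩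
  · exact ⟨0, 1, one_pos, fun x => by
      rw [logDensity_of_notMem (by simp)]; exact (Real.exp_pos _).le⟩
  suffices ∃ a b : ℝ, 0 < b ∧ ∀ x ∈ S, φ x ≤ a - b * x by
    obtain ⟨a, b, hb, h⟩ := this
    refine ⟨a, b, hb, fun x => ?_⟩
    by_cases hx : x ∈ S
    · rw [logDensity_of_mem hx]
      exact Real.exp_le_exp.2 (h x hx)
    · rw [logDensity_of_notMem hx]
      exact (Real.exp_pos _).le
  by_cases hneg : ∃ x₁ ∈ S, ∃ m < 0, ∀ y ∈ S, φ y ≤ φ x₁ + m * (y - x₁)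
  · obtain ⟨x₁, -, m, hm, h⟩ := hneg
    exact ⟨φ x₁ - m * x₁, -m, by linarith, fun x hx => by linarith [h x hx]⟩
  push Not at hneg
  have hbdd : BddAbove S := by
    by_contra hub
    have hsub : Ioi x₀ ⊆ S := by
      intro x _
      obtain ⟨y, hy, hxy⟩ := not_bddAbove_iff.1 hub x
      exact hφ.1.ordConnected.out hx₀ hy ⟨le_of_lt ‹_›, hxy.le⟩
    have hge : ∀ x ∈ Ioi x₀, Real.exp (φ x₀) ≤ logDensity S φ x := by
      intro x hx
      rw [logDensity_of_mem (hsub hx)]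
      refine Real.exp_le_exp.2 ?_
      obtain ⟨m, hm⟩ := hφ.exists_supergradient hS (hsub hx)
      have hm0 : 0 ≤ m := by
        by_contra! h
        obtain ⟨y, hy, hy'⟩ := hneg x (hsub hx) m h
        exact absurd (hm y hy) (not_le.2 hy')
      have := hm x₀ hx₀
      nlinarith [mem_Ioi.1 hx]
    have hint : IntegrableOn (fun _ => Real.exp (φ x₀)) (Ioi x₀) := by
      refine hi.integrableOn.mono' (by fun_prop) ?_
      filter_upwards [ae_restrict_mem measurableSet_Ioi] with x hx
      rw [Real.norm_eq_abs, abs_of_pos (Real.exp_pos _)]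
      exact hge x hx
    rw [integrableOn_const_iff] at hint
    simp [(Real.exp_pos _).ne'] at hint
  obtain ⟨B, hB⟩ := hbdd
  obtain ⟨m, hm⟩ := hφ.exists_supergradient hS hx₀
  have hm0 : 0 ≤ m := by
    by_contra! h
    obtain ⟨y, hy, hy'⟩ := hneg x₀ hx₀ m h
    exact absurd (hm y hy) (not_le.2 hy')
  refine ⟨φ x₀ - m * x₀ + (m + 1) * B, 1, one_pos, fun x hx => ?_⟩
  nlinarith [hm x hx, hB hx]

lemma integrable_pow_mul_logDensity {S : Set ℝ} {φ : ℝ → ℝ} (hS : IsOpen S)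
    (hφ : ConcaveOn ℝ S φ) (hi : Integrable (logDensity S φ)) :
    Integrable fun x => (1 + |x|) ^ 3 * logDensity S φ x := by
  obtain ⟨a, b, hb, h1⟩ := exists_logDensity_le_exp_sub hS hφ hi
  obtain ⟨a', b', hb', h2⟩ := exists_logDensity_le_exp_sub (hS.preimage continuous_neg)
    hφ.comp_neg_real (hi.comp_neg.congr (Eventually.of_forall fun x => (logDensity_neg S φ x).symm))
  have h3 : ∀ x, logDensity S φ x ≤ Real.exp (a' + b' * x) := by
    intro x
    have := h2 (-x)
    rw [logDensity_neg, neg_neg] at this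
    simpa using this
  set c := min b b'
  have hc : 0 < c := lt_min hb hb'
  have h4 : ∀ x, logDensity S φ x ≤ Real.exp (max a a' + c) * Real.exp (-(c * (1 + |x|))) := by
    intro x
    rw [← Real.exp_add]
    rcases le_total 0 x with hx | hx
    · refine (h1 x).trans (Real.exp_le_exp.2 ?_)
      rw [abs_of_nonneg hx]
      nlinarith [le_max_left a a', min_le_left b b']
    · refine (h3 x).trans (Real.exp_le_exp.2 ?_)
      rw [abs_of_nonpos hx]
      nlinarith [le_max_right a a', min_le_right b b']
  refine (integrable_inv_one_add_sq.const_mul (Real.exp (max a a' + c) * (120 / c ^ 5))).mono'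
    (((by fun_prop : Continuous fun x : ℝ => (1 + |x|) ^ 3).measurable.mul
      (measurable_logDensity hS hφ)).aestronglyMeasurable) (Eventually.of_forall fun x => ?_)
  rw [Real.norm_eq_abs, abs_of_nonneg (mul_nonneg (by positivity) (logDensity_nonneg x))]
  have hx := abs_nonneg x
  have h5 := Real.pow_div_factorial_le_exp (c * (1 + |x|)) (by positivity) 5
  have h6 : (1 + |x|) ^ 3 * (1 + x ^ 2) ≤ (1 + |x|) ^ 5 := by
    rw [show (1 + |x|) ^ 5 = (1 + |x|) ^ 3 * (1 + |x|) ^ 2 by ring]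
    refine mul_le_mul_of_nonneg_left ?_ (by positivity)
    nlinarith [sq_abs x]
  have h7 : (1 + |x|) ^ 3 * (1 + x ^ 2) * Real.exp (-(c * (1 + |x|))) ≤ 120 / c ^ 5 := by
    rw [Real.exp_neg, ← div_eq_mul_inv, div_le_div_iff₀ (Real.exp_pos _) (by positivity)]
    rw [mul_pow, div_le_iff₀ (by positivity)] at h5
    have h8 : ((Nat.factorial 5 : ℕ) : ℝ) = 120 := by norm_num [Nat.factorial]
    rw [h8] at h5
    nlinarith [mul_le_mul_of_nonneg_left h6 (by positivity : 0 ≤ c ^ 5)]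
  rw [← div_eq_mul_inv, le_div_iff₀ (by positivity)]
  calc (1 + |x|) ^ 3 * logDensity S φ x * (1 + x ^ 2)
      ≤ (1 + |x|) ^ 3 * (Real.exp (max a a' + c) * Real.exp (-(c * (1 + |x|)))) * (1 + x ^ 2) := by
        gcongr
        exact h4 x
    _ = Real.exp (max a a' + c) * ((1 + |x|) ^ 3 * (1 + x ^ 2) * Real.exp (-(c * (1 + |x|)))) := by
        ring
    _ ≤ _ := by gcongr

lemma abs_exp_sub_one_le_mul_exp {t C : ℝ} (hC : 0 ≤ C) (ht : t ≤ C) :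
    |Real.exp t - 1| ≤ |t| * Real.exp C := by
  rcases le_total 0 t with h | h
  · rw [abs_of_nonneg (by linarith [Real.add_one_le_exp t]), abs_of_nonneg h]
    have h1 : Real.exp t - 1 ≤ t * Real.exp t := by
      have h2 := Real.add_one_le_exp (-t)
      have h3 : Real.exp (-t) * Real.exp t = 1 := by rw [← Real.exp_add]; simp
      nlinarith [Real.exp_pos t]
    exact h1.trans (mul_le_mul_of_nonneg_left (Real.exp_le_exp.2 ht) h)
  · rw [abs_of_nonpos (by linarith [Real.exp_le_one_iff.2 h]), abs_of_nonpos h]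
    nlinarith [Real.add_one_le_exp t, Real.one_le_exp hC]

lemma tendsto_exp_mul_sub_one_div (a : ℝ) {ε : ℕ → ℝ} (hε : ∀ k, ε k ≠ 0)
    (hε0 : Tendsto ε atTop (nhds 0)) :
    Tendsto (fun k => (Real.exp (ε k * a) - 1) / ε k) atTop (nhds a) := by
  have h1 : HasDerivAt (fun t : ℝ => Real.exp (t * a)) a 0 := by
    have h2 := ((hasDerivAt_id (0 : ℝ)).mul_const a).exp
    simpa using h2
  have h2 := h1.tendsto_slope_zero.comp
    (tendsto_nhdsWithin_iff.2 ⟨hε0, Eventually.of_forall hε⟩)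
  refine h2.congr fun k => ?_
  simp [div_eq_inv_mul]

section

variable {S : Set ℝ} {φ : ℝ → ℝ}

lemma integrable_sq_logMeasure (hS : IsOpen S) (hφ : ConcaveOn ℝ S φ)
    (hi : Integrable (logDensity S φ)) :
    Integrable (fun x => (1 + |x|) ^ 2) (logMeasure S φ) := by
  rw [integrable_logMeasure_iff hS hφ]
  refine (integrable_pow_mul_logDensity hS hφ hi).mono' ?_ (Eventually.of_forall fun x => ?_)
  · exact ((measurable_logDensity hS hφ).mul (by fun_prop)).aestronglyMeasurable
  · have h0 : 0 ≤ logDensity S φ x := logDensity_nonneg x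
    rw [Real.norm_eq_abs, abs_of_nonneg (by positivity), mul_comm]
    refine mul_le_mul_of_nonneg_right (pow_le_pow_right₀ ?_ (by norm_num)) h0
    linarith [abs_nonneg x]

lemma injOn_measureReal_Iic_logMeasure (hS : IsOpen S) (hφ : ConcaveOn ℝ S φ)
    [IsFiniteMeasure (logMeasure S φ)] : InjOn (fun y => (logMeasure S φ).real (Iic y)) S := by
  have hi := integrable_logDensity hS hφ
  refine StrictMonoOn.injOn fun y hy z hz hyz => ?_
  simp only [measureReal_logMeasure hS hφ measurableSet_Iic]
  rw [← sub_pos, intervalIntegral.integral_Iic_sub_Iic hi.integrableOn hi.integrableOn]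
  refine intervalIntegral.intervalIntegral_pos_of_pos_on hi.intervalIntegrable (fun x hx => ?_) hyz
  rw [logDensity_of_mem (hφ.1.ordConnected.out hy hz ⟨hx.1.le, hx.2.le⟩)]
  exact Real.exp_pos _

lemma logDensity_add (ψ : ℝ → ℝ) (x : ℝ) :
    logDensity S (fun x => φ x + ψ x) x = logDensity S φ x * Real.exp (ψ x) := by
  by_cases hx : x ∈ S
  · rw [logDensity_of_mem hx, logDensity_of_mem hx, Real.exp_add]
  · rw [logDensity_of_notMem hx, logDensity_of_notMem hx, zero_mul]

lemma logDensity_sub_log {Z : ℝ} (hZ : 0 < Z) (x : ℝ) :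
    logDensity S (fun x => φ x - Real.log Z) x = logDensity S φ x / Z := by
  have := logDensity_add (S := S) (φ := φ) (fun _ => -Real.log Z) x
  rw [Real.exp_neg, Real.exp_log hZ, ← div_eq_mul_inv] at this
  exact this

lemma measurable_logDensity_mul (hS : IsOpen S) (hφ : ConcaveOn ℝ S φ) {g : ℝ → ℝ}
    (hg : ContinuousOn g S) : Measurable fun x => logDensity S φ x * g x := by
  have : (fun x => logDensity S φ x * g x) = fun x => logDensity S φ x * S.indicator g x := by
    ext x
    by_cases hx : x ∈ S
    · rw [indicator_of_mem hx]
    · rw [logDensity_of_notMem hx, zero_mul, zero_mul]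
  rw [this]
  exact (measurable_logDensity hS hφ).mul (measurable_indicator_of_continuousOn hS.measurableSet hg)

variable {ψ : ℝ → ℝ} {C : ℝ}

lemma integrable_logDensity_add_mul (hS : IsOpen S)
    (hi : Integrable (logDensity S φ)) (hC : 0 ≤ C) (hψC : ∀ x ∈ S, ψ x ≤ C)
    {ε : ℝ} (hε : ε ∈ Ioc (0 : ℝ) 1) (hψ : ConcaveOn ℝ S fun x => φ x + ε * ψ x) :
    (∀ x, logDensity S (fun x => φ x + ε * ψ x) x ≤ Real.exp C * logDensity S φ x) ∧
      Integrable (logDensity S fun x => φ x + ε * ψ x) := by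
  have hle : ∀ x, logDensity S (fun x => φ x + ε * ψ x) x ≤ Real.exp C * logDensity S φ x := by
    intro x
    by_cases hx : x ∈ S
    · rw [logDensity_add (fun x => ε * ψ x), mul_comm]
      refine mul_le_mul_of_nonneg_right (Real.exp_le_exp.2 ?_) (logDensity_nonneg x)
      nlinarith [hψC x hx, hε.1, hε.2]
    · simp [logDensity_of_notMem hx]
  refine ⟨hle, (hi.const_mul (Real.exp C)).mono'
    (measurable_logDensity hS hψ).aestronglyMeasurable (Eventually.of_forall fun x => ?_)⟩
  rw [Real.norm_eq_abs, abs_of_nonneg (logDensity_nonneg x)]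
  exact hle x

lemma integral_logDensity_pos (hS : IsOpen S) (hne : S.Nonempty)
    (hi : Integrable (logDensity S φ)) : 0 < ∫ x, logDensity S φ x := by
  rw [integral_pos_iff_support_of_nonneg logDensity_nonneg hi]
  refine (hS.measure_pos volume hne).trans_le (measure_mono fun x hx => ?_)
  rw [Function.mem_support, logDensity_of_mem hx]
  exact Real.exp_ne_zero _

/-- The potentials of a convergent sequence of perturbations converge. -/
lemma tendsto_potential {q : ℝ → ℝ} (hq : Monotone q) {M : ℝ} (hM : ∀ u, |q u| ≤ M)
    (hS : IsOpen S) (hφ : ConcaveOn ℝ S φ) [IsProbabilityMeasure (logMeasure S φ)]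
    (ν : ℕ → Measure ℝ) [∀ k, IsProbabilityMeasure (ν k)]
    (hν : ∀ y, Tendsto (fun k => (ν k).real (Iic y)) atTop (nhds ((logMeasure S φ).real (Iic y))))
    {x₀ x : ℝ} (hx₀ : x₀ ∈ S) (hx : x ∈ S) :
    Tendsto (fun k => potential q (ν k) x₀ x) atTop
      (nhds (potential q (logMeasure S φ) x₀ x)) := by
  have hcount : (S ∩ {y | ¬ ContinuousAt q ((logMeasure S φ).real (Iic y))}).Countable := by
    refine countable_of_injective_of_countable_image
      ((injOn_measureReal_Iic_logMeasure hS hφ).mono inter_subset_left)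
      (hq.countable_not_continuousAt.mono ?_)
    rintro _ ⟨y, hy, rfl⟩
    exact hy.2
  have hae : ∀ᵐ y : ℝ, y ∉ S ∩ {y | ¬ ContinuousAt q ((logMeasure S φ).real (Iic y))} :=
    measure_eq_zero_iff_ae_notMem.1 (hcount.measure_zero volume)
  refine intervalIntegral.tendsto_integral_filter_of_dominated_convergence (fun y => |y| + M)
    (Eventually.of_forall fun k => ?_) (Eventually.of_forall fun k => ?_) ?_ ?_
  · exact (measurable_id.sub
      (monotone_comp_measureReal_Iic hq (ν k)).measurable).aestronglyMeasurable
  · refine Eventually.of_forall fun y _ => ?_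
    rw [Real.norm_eq_abs]
    linarith [abs_sub y (q ((ν k).real (Iic y))), hM ((ν k).real (Iic y))]
  · exact (by fun_prop : Continuous fun y : ℝ => |y| + M).intervalIntegrable _ _
  · filter_upwards [hae] with y hy hyx
    have hyS : y ∈ S := hφ.1.ordConnected.uIcc_subset hx₀ hx (uIoc_subset_uIcc hyx)
    have hcont : ContinuousAt q ((logMeasure S φ).real (Iic y)) := by
      by_contra h
      exact hy ⟨hyS, h⟩
    exact tendsto_const_nhds.sub (hcont.tendsto.comp (hν y))

/-- The first-order optimality condition along the perturbations `φ + ε ψ`. -/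
lemma first_variation_nonneg {q : ℝ → ℝ} (hq : Monotone q) {M : ℝ} (hM : ∀ u, |q u| ≤ M)
    (hS : IsOpen S) (hφ : ConcaveOn ℝ S φ) [IsProbabilityMeasure (logMeasure S φ)]
    (hmin : ∀ ν ∈ Flc, ∫ u in Ioo (0 : ℝ) 1, (quantile (logMeasure S φ) u - q u) ^ 2 ≤
      ∫ u in Ioo (0 : ℝ) 1, (quantile ν u - q u) ^ 2)
    {x₀ : ℝ} (hx₀ : x₀ ∈ S) (hC : 0 ≤ C) (hψC : ∀ x ∈ S, ψ x ≤ C)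
    (hψabs : ∀ x ∈ S, |ψ x| ≤ C * (1 + |x|)) (hψcont : ContinuousOn ψ S)
    (hψ : ∀ ε ∈ Ioc (0 : ℝ) 1, ConcaveOn ℝ S fun x => φ x + ε * ψ x) :
    let R := potential q (logMeasure S φ) x₀
    Integrable (fun x => logDensity S φ x * (ψ x * (R x - ∫ y, R y ∂logMeasure S φ))) ∧
    0 ≤ ∫ x, logDensity S φ x * (ψ x * (R x - ∫ y, R y ∂logMeasure S φ)) := by
  intro R
  have hi := integrable_logDensity hS hφ
  have hmeas := measurable_logDensity hS hφ
  have hmom := integrable_pow_mul_logDensity hS hφ hi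
  have hf0 : ∀ x, 0 ≤ logDensity S φ x := logDensity_nonneg
  set ε : ℕ → ℝ := fun k => 1 / ((k : ℝ) + 1) with hεdef
  have hε : ∀ k, ε k ∈ Ioc (0 : ℝ) 1 := fun k =>
    ⟨Nat.one_div_pos_of_nat, by
      rw [hεdef, div_le_one (by positivity)]
      linarith [(Nat.cast_nonneg k : (0 : ℝ) ≤ k)]⟩
  have hε0 : Tendsto ε atTop (nhds 0) := tendsto_one_div_add_atTop_nhds_zero_nat
  set g : ℕ → ℝ → ℝ := fun k => logDensity S fun x => φ x + ε k * ψ x with hg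
  have hgc : ∀ k, ConcaveOn ℝ S fun x => φ x + ε k * ψ x := fun k => hψ _ (hε k)
  have hgle : ∀ k x, g k x ≤ Real.exp C * logDensity S φ x := fun k =>
    (integrable_logDensity_add_mul hS hi hC hψC (hε k) (hgc k)).1
  have hgi : ∀ k, Integrable (g k) := fun k =>
    (integrable_logDensity_add_mul hS hi hC hψC (hε k) (hgc k)).2
  have hgx : ∀ k x, g k x = logDensity S φ x * Real.exp (ε k * ψ x) := fun k x =>
    logDensity_add (fun x => ε k * ψ x) x
  have hg0 : ∀ k x, 0 ≤ g k x := fun k x => logDensity_nonneg x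
  set Z : ℕ → ℝ := fun k => ∫ x, g k x
  have hZ : ∀ k, 0 < Z k := fun k => integral_logDensity_pos hS ⟨x₀, hx₀⟩ (hgi k)
  have hglim : ∀ x, Tendsto (fun k => g k x) atTop (nhds (logDensity S φ x)) := by
    intro x
    simp only [hgx]
    have h1 : Tendsto (fun k => logDensity S φ x * Real.exp (ε k * ψ x)) atTop
        (nhds (logDensity S φ x * Real.exp (0 * ψ x))) :=
      ((Real.continuous_exp.tendsto _).comp (hε0.mul_const (ψ x))).const_mul _
    simpa using h1
  have hgint : ∀ A : Set ℝ, Tendsto (fun k => ∫ x in A, g k x) atTop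
      (nhds (∫ x in A, logDensity S φ x)) := fun A =>
    tendsto_integral_of_dominated_convergence (fun x => Real.exp C * logDensity S φ x)
      (fun k => (hgi k).aestronglyMeasurable.restrict) (hi.const_mul _).integrableOn
      (fun k => Eventually.of_forall fun x => by
        rw [Real.norm_eq_abs, abs_of_nonneg (hg0 k x)]; exact hgle k x)
      (Eventually.of_forall hglim)
  have hZ1 : Tendsto Z atTop (nhds 1) := by
    have := hgint univ
    simpa only [Measure.restrict_univ, integral_logDensity hS hφ] using this
  set φ' : ℕ → ℝ → ℝ := fun k x => φ x + ε k * ψ x - Real.log (Z k) with hφ'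
  have hφ'c : ∀ k, ConcaveOn ℝ S (φ' k) := fun k => by
    have := (hgc k).add_const (-Real.log (Z k))
    exact this
  have hφ'd : ∀ k x, logDensity S (φ' k) x = g k x / Z k := fun k x => logDensity_sub_log (hZ k) x
  have hφ'i : ∀ k, Integrable (logDensity S (φ' k)) := fun k => by
    rw [funext (hφ'd k)]
    exact (hgi k).div_const _
  have hprob : ∀ k, IsProbabilityMeasure (logMeasure S (φ' k)) := fun k => by
    refine isProbabilityMeasure_logMeasure (hφ'i k) ?_
    simp only [hφ'd, integral_div]
    exact div_self (hZ k).ne'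
  set Rk : ℕ → ℝ → ℝ := fun k => potential q (logMeasure S (φ' k)) x₀ with hRk
  have hRkc : ∀ k, Continuous (Rk k) := fun k => continuous_potential hq _ _
  have hRc : Continuous R := continuous_potential hq _ _
  set D := (1 + |x₀| + M) ^ 2
  have hD : 0 ≤ D := sq_nonneg _
  have hRkD : ∀ k x, |Rk k x| ≤ D * (1 + |x|) ^ 2 := fun k => abs_potential_le hM _ _
  have hRD : ∀ x, |R x| ≤ D * (1 + |x|) ^ 2 := abs_potential_le hM _ _
  have hRlim : ∀ x ∈ S, Tendsto (fun k => Rk k x) atTop (nhds (R x)) := fun x hx => by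
    refine tendsto_potential hq hM hS hφ _ (fun y => ?_) hx₀ hx
    simp only [measureReal_logMeasure hS (hφ'c _) measurableSet_Iic,
      measureReal_logMeasure hS hφ measurableSet_Iic, hφ'd, integral_div]
    have h := (hgint (Iic y)).div hZ1 one_ne_zero
    rw [div_one] at h
    exact h
  have hsq : Integrable (fun x => (1 + |x|) ^ 2) (logMeasure S φ) :=
    integrable_sq_logMeasure hS hφ hi
  have hRkf : ∀ k, Integrable fun x => logDensity S φ x * Rk k x := fun k =>
    (integrable_logMeasure_iff hS hφ _).1 (integrable_potential hq hM _ _ hsq x₀)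
  have hRf : Integrable fun x => logDensity S φ x * R x :=
    (integrable_logMeasure_iff hS hφ _).1 (integrable_potential hq hM _ _ hsq x₀)
  have hRkg : ∀ k, Integrable fun x => g k x * Rk k x := fun k => by
    have := (integrable_logMeasure_iff hS (hφ'c k) _).1 (integrable_potential hq hM
      (logMeasure S (φ' k)) _ (integrable_sq_logMeasure hS (hφ'c k) (hφ'i k)) x₀)
    refine (this.const_mul (Z k)).congr (Eventually.of_forall fun x => ?_)
    simp only [hφ'd]
    field_simp [(hZ k).ne']
    rfl
  set w : ℕ → ℝ → ℝ := fun k x => logDensity S φ x * ((Real.exp (ε k * ψ x) - 1) / ε k) with hw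
  have hwg : ∀ k x, w k x = (ε k)⁻¹ * (g k x - logDensity S φ x) := fun k x => by
    simp only [hw, hgx]
    ring
  have hwi : ∀ k, Integrable (w k) := fun k => by
    rw [funext (hwg k)]
    exact ((hgi k).sub hi).const_mul _
  have hineq : ∀ k, 0 ≤ (∫ x, w k x * Rk k x) - (∫ x, w k x) * ∫ x, logDensity S φ x * Rk k x := by
    intro k
    have h1 := hmin _ (logMeasure_mem_Flc (hφ'c k))
    have h2 := integral_quantile_sub_le hq hM (logMeasure S φ) (logMeasure S (φ' k)) hsq
      (integrable_sq_logMeasure hS (hφ'c k) (hφ'i k)) x₀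
    rw [integral_logMeasure hS hφ, integral_logMeasure hS (hφ'c k)] at h2
    have h3 : ∫ x, logDensity S (φ' k) x * Rk k x = (∫ x, g k x * Rk k x) / Z k := by
      rw [← integral_div]
      refine integral_congr_ae (Eventually.of_forall fun x => ?_)
      simp only [hφ'd]
      ring
    have h4 : ∫ x, logDensity S φ x * Rk k x ≤ (∫ x, g k x * Rk k x) / Z k := by
      rw [← h3]
      linarith
    rw [le_div_iff₀ (hZ k)] at h4
    have h5 : ∫ x, w k x * Rk k x =
        (ε k)⁻¹ * ((∫ x, g k x * Rk k x) - ∫ x, logDensity S φ x * Rk k x) := by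
      rw [← integral_sub (hRkg k) (hRkf k), ← integral_const_mul]
      refine integral_congr_ae (Eventually.of_forall fun x => ?_)
      simp only [hwg]
      ring
    have h6 : ∫ x, w k x = (ε k)⁻¹ * (Z k - 1) := by
      rw [funext (hwg k), integral_const_mul, integral_sub (hgi k) hi, integral_logDensity hS hφ]
    rw [h5, h6, mul_assoc, ← mul_sub]
    refine mul_nonneg (inv_nonneg.2 (hε k).1.le) ?_
    linarith
  have hwbound : ∀ k x, |w k x| ≤ C * Real.exp C * ((1 + |x|) * logDensity S φ x) := by
    intro k x
    by_cases hx : x ∈ S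
    · have h1 : ε k * ψ x ≤ C := by nlinarith [hψC x hx, (hε k).1, (hε k).2]
      have h2 := abs_exp_sub_one_le_mul_exp hC h1
      rw [abs_mul, abs_of_pos (hε k).1] at h2
      rw [hw, abs_mul, abs_of_nonneg (hf0 x), abs_div, abs_of_pos (hε k).1]
      calc logDensity S φ x * (|Real.exp (ε k * ψ x) - 1| / ε k)
          ≤ logDensity S φ x * (C * (1 + |x|) * Real.exp C) := by
            refine mul_le_mul_of_nonneg_left ?_ (hf0 x)
            rw [div_le_iff₀ (hε k).1]
            refine h2.trans ?_
            have := mul_le_mul_of_nonneg_left (hψabs x hx)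
              (mul_nonneg (hε k).1.le (Real.exp_pos C).le)
            linarith
        _ = _ := by ring
    · simp [hw, logDensity_of_notMem hx]
  have hwlim : ∀ x, Tendsto (fun k => w k x) atTop (nhds (logDensity S φ x * ψ x)) := fun x =>
    (tendsto_exp_mul_sub_one_div (ψ x) (fun k => (hε k).1.ne') hε0).const_mul _
  have hb1 : ∀ x, (1 : ℝ) ≤ 1 + |x| := fun x => by linarith [abs_nonneg x]
  have hψmeas := measurable_logDensity_mul hS hφ hψcont
  have hψf : ∀ x, |logDensity S φ x * ψ x| ≤ C * ((1 + |x|) * logDensity S φ x) := by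
    intro x
    by_cases hx : x ∈ S
    · rw [abs_mul, abs_of_nonneg (hf0 x)]
      nlinarith [hψabs x hx, hf0 x, mul_le_mul_of_nonneg_left (hψabs x hx) (hf0 x)]
    · simp [logDensity_of_notMem hx]
  have hmom1 : ∀ x, (1 + |x|) * logDensity S φ x ≤ (1 + |x|) ^ 3 * logDensity S φ x := fun x =>
    mul_le_mul_of_nonneg_right (le_self_pow₀ (hb1 x) (by norm_num)) (hf0 x)
  have hmom2 : ∀ x, (1 + |x|) ^ 2 * logDensity S φ x ≤ (1 + |x|) ^ 3 * logDensity S φ x := fun x =>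
    mul_le_mul_of_nonneg_right (pow_le_pow_right₀ (hb1 x) (by norm_num)) (hf0 x)
  have hψi : Integrable fun x => logDensity S φ x * ψ x := by
    refine (hmom.const_mul C).mono' hψmeas.aestronglyMeasurable (Eventually.of_forall fun x => ?_)
    exact (hψf x).trans (mul_le_mul_of_nonneg_left (hmom1 x) hC)
  have hψRi : Integrable fun x => (logDensity S φ x * ψ x) * R x := by
    refine (hmom.const_mul (C * D)).mono' (hψmeas.mul hRc.measurable).aestronglyMeasurable
      (Eventually.of_forall fun x => ?_)
    rw [Real.norm_eq_abs, abs_mul]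
    refine (mul_le_mul (hψf x) (hRD x) (abs_nonneg _) ?_).trans (le_of_eq (by ring))
    exact mul_nonneg hC (mul_nonneg (by linarith [hb1 x]) (hf0 x))
  have l1 : Tendsto (fun k => ∫ x, w k x * Rk k x) atTop
      (nhds (∫ x, (logDensity S φ x * ψ x) * R x)) := by
    refine tendsto_integral_of_dominated_convergence _
      (fun k => ((hwi k).aestronglyMeasurable.mul (hRkc k).aestronglyMeasurable))
      (hmom.const_mul (C * Real.exp C * D))
      (fun k => Eventually.of_forall fun x => ?_) (Eventually.of_forall fun x => ?_)
    · rw [Real.norm_eq_abs, abs_mul]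
      refine (mul_le_mul (hwbound k x) (hRkD k x) (abs_nonneg _) ?_).trans (le_of_eq (by ring))
      exact mul_nonneg (by positivity) (mul_nonneg (by linarith [hb1 x]) (hf0 x))
    · by_cases hx : x ∈ S
      · exact (hwlim x).mul (hRlim x hx)
      · simp [hw, logDensity_of_notMem hx]
  have l2 : Tendsto (fun k => ∫ x, w k x) atTop (nhds (∫ x, logDensity S φ x * ψ x)) := by
    refine tendsto_integral_of_dominated_convergence _
      (fun k => (hwi k).aestronglyMeasurable) (hmom.const_mul (C * Real.exp C))
      (fun k => Eventually.of_forall fun x => ?_) (Eventually.of_forall hwlim)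
    exact (hwbound k x).trans (mul_le_mul_of_nonneg_left (hmom1 x) (by positivity))
  have l3 : Tendsto (fun k => ∫ x, logDensity S φ x * Rk k x) atTop
      (nhds (∫ x, logDensity S φ x * R x)) := by
    refine tendsto_integral_of_dominated_convergence _
      (fun k => (hRkf k).aestronglyMeasurable) (hmom.const_mul D)
      (fun k => Eventually.of_forall fun x => ?_) (Eventually.of_forall fun x => ?_)
    · rw [Real.norm_eq_abs, abs_mul, abs_of_nonneg (hf0 x)]
      have := mul_le_mul_of_nonneg_left (hRkD k x) (hf0 x)
      have := mul_le_mul_of_nonneg_left (hmom2 x) hD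
      linarith
    · by_cases hx : x ∈ S
      · exact (hRlim x hx).const_mul _
      · simp [logDensity_of_notMem hx]
  have hlim := ge_of_tendsto' (l1.sub (l2.mul l3)) hineq
  have heq : (fun x => logDensity S φ x * (ψ x * (R x - ∫ y, R y ∂logMeasure S φ))) =
      fun x => (logDensity S φ x * ψ x) * R x -
        (logDensity S φ x * ψ x) * ∫ y, logDensity S φ y * R y := by
    rw [integral_logMeasure hS hφ]
    ext x
    ring
  rw [heq]
  refine ⟨hψRi.sub (hψi.mul_const _), ?_⟩
  rwa [integral_sub hψRi (hψi.mul_const _), integral_mul_const]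

end

/-- First-order optimality of a concave log-density `φ` on `S`, where `G` is the variational
derivative of the functional being minimized: an admissible perturbation `ψ` with `G ψ ≤ 0`
satisfies `G ψ = 0`. -/
def IsCritical (S : Set ℝ) (φ G : ℝ → ℝ) : Prop :=
  ∀ (ψ : ℝ → ℝ) (C : ℝ), 0 ≤ C → (∀ x ∈ S, ψ x ≤ C) → (∀ x ∈ S, |ψ x| ≤ C * (1 + |x|)) →
    (∀ ε ∈ Ioc (0 : ℝ) 1, ConcaveOn ℝ S fun x => φ x + ε * ψ x) →
    (∀ x ∈ S, G x * ψ x ≤ 0) → ∀ x ∈ S, G x = 0 ∨ ψ x = 0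

lemma isCritical_potential {S : Set ℝ} {φ q : ℝ → ℝ} (hq : Monotone q) {M : ℝ}
    (hM : ∀ u, |q u| ≤ M)
    (hS : IsOpen S) (hφ : ConcaveOn ℝ S φ) [IsProbabilityMeasure (logMeasure S φ)]
    (hmin : ∀ ν ∈ Flc, ∫ u in Ioo (0 : ℝ) 1, (quantile (logMeasure S φ) u - q u) ^ 2 ≤
      ∫ u in Ioo (0 : ℝ) 1, (quantile ν u - q u) ^ 2)
    {x₀ : ℝ} (hx₀ : x₀ ∈ S) :
    IsCritical S φ fun x => potential q (logMeasure S φ) x₀ x -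
      ∫ y, potential q (logMeasure S φ) x₀ y ∂logMeasure S φ := by
  intro ψ C hC hψC hψabs hψ hsign x hx
  have hψcont : ContinuousOn ψ S := by
    have h := ((hψ 1 ⟨one_pos, le_rfl⟩).continuousOn hS).sub (hφ.continuousOn hS)
    exact h.congr fun y _ => by simp
  obtain ⟨hint, hnn⟩ := first_variation_nonneg hq hM hS hφ hmin hx₀ hC hψC hψabs hψcont hψ
  set R := potential q (logMeasure S φ) x₀
  set c := ∫ y, R y ∂logMeasure S φ
  by_contra! hne
  have hle : ∀ y, 0 ≤ -(logDensity S φ y * (ψ y * (R y - c))) := fun y => by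
    by_cases hy : y ∈ S
    · have h1 := hsign y hy
      have h2 := logDensity_nonneg (S := S) (φ := φ) y
      rw [mul_comm] at h1
      nlinarith [mul_nonneg h2 (neg_nonneg.2 h1)]
    · simp [logDensity_of_notMem hy]
  have hpos : 0 < ∫ y, -(logDensity S φ y * (ψ y * (R y - c))) := by
    rw [integral_pos_iff_support_of_nonneg hle hint.neg]
    have hU : IsOpen (S ∩ (fun y => ψ y * (R y - c)) ⁻¹' {0}ᶜ) :=
      (hψcont.mul ((continuous_potential hq _ _).sub continuous_const).continuousOn)
        |>.isOpen_inter_preimage hS isOpen_compl_singleton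
    refine (hU.measure_pos volume ⟨x, hx, ?_⟩).trans_le (measure_mono fun y hy => ?_)
    · exact mul_ne_zero hne.2 hne.1
    · rw [Function.mem_support, logDensity_of_mem hy.1]
      exact neg_ne_zero.2 (mul_ne_zero (Real.exp_pos _).ne' hy.2)
  rw [integral_neg] at hpos
  linarith

section IsCritical

variable {S : Set ℝ} {φ G : ℝ → ℝ}

lemma concaveOn_affine (hS : Convex ℝ S) (α β : ℝ) : ConcaveOn ℝ S fun x => α + β * x :=
  (concaveOn_const α hS).add (((LinearMap.mul ℝ ℝ β).concaveOn hS))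

/-- Lowering the log-density where `G ≥ 0`. -/
lemma IsCritical.lower (hG : IsCritical S φ G) (hφ : ConcaveOn ℝ S φ) {h : ℝ → ℝ} {C : ℝ}
    (hC : 0 ≤ C) (hh : ConcaveOn ℝ S h) (hle : ∀ x ∈ S, h x ≤ φ x)
    (hbd : ∀ x ∈ S, φ x - h x ≤ C * (1 + |x|)) (hsign : ∀ x ∈ S, 0 ≤ G x ∨ h x = φ x) :
    ∀ x ∈ S, G x = 0 ∨ h x = φ x := by
  intro x hx
  have := hG (fun x => h x - φ x) C hC (fun x hx => by linarith [hle x hx])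
    (fun x hx => by rw [abs_sub_comm, abs_of_nonneg (by linarith [hle x hx])]; exact hbd x hx)
    (fun ε hε => ?_) (fun x hx => ?_) x hx
  · simpa [sub_eq_zero] using this
  · have := (hφ.smul (sub_nonneg.2 hε.2)).add (hh.smul hε.1.le)
    refine this.congr fun x _ => ?_
    simp only [Pi.add_apply, smul_eq_mul]
    ring
  · rcases hsign x hx with h0 | h0
    · nlinarith [hle x hx]
    · simp [h0]

/-- Raising the log-density where `G ≤ 0`. -/
lemma IsCritical.raise (hG : IsCritical S φ G) (hφ : ConcaveOn ℝ S φ) {h : ℝ → ℝ}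
    (hh : ConcaveOn ℝ S h) (hle : ∀ x ∈ S, φ x ≤ h x) (hsign : ∀ x ∈ S, G x ≤ 0 ∨ h x = φ x) :
    ∀ x ∈ S, G x = 0 ∨ h x = φ x := by
  intro x hx
  have h0 : ∀ x ∈ S, 0 ≤ min (h x - φ x) 1 := fun x hx =>
    le_min (by linarith [hle x hx]) zero_le_one
  have := hG (fun x => min (h x - φ x) 1) 1 zero_le_one (fun x hx => min_le_right _ _)
    (fun x hx => by
      rw [abs_of_nonneg (h0 x hx)]
      linarith [min_le_right (h x - φ x) 1, abs_nonneg x])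
    (fun ε hε => ?_) (fun x hx => ?_) x hx
  · refine this.imp_right fun h1 => ?_
    rcases min_choice (h x - φ x) 1 with h2 | h2 <;> rw [h2] at h1 <;> linarith
  · have := ((hφ.smul (sub_nonneg.2 hε.2)).add (hh.smul hε.1.le)).inf
      (hφ.add (concaveOn_const ε hφ.1))
    refine this.congr fun x _ => ?_
    simp only [Pi.inf_apply, Pi.add_apply, smul_eq_mul]
    rw [mul_min_of_nonneg _ _ hε.1.le, ← min_add_add_left]
    congr 1 <;> ring
  · rcases hsign x hx with h1 | h1
    · exact mul_nonpos_of_nonpos_of_nonneg h1 (h0 x hx)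
    · simp [h1]

lemma IsCritical.exists_nonpos_right (hG : IsCritical S φ G) (hS : IsOpen S)
    (hφ : ConcaveOn ℝ S φ) {d : ℝ} (hd : d ∈ S) : ∃ x ∈ S, d < x ∧ G x ≤ 0 := by
  by_contra! hpos
  obtain ⟨x, hxd, hx⟩ : ∃ x, d < x ∧ x ∈ S := by
    obtain ⟨l, hl, hlS⟩ := exists_Ico_subset_of_mem_nhds (hS.mem_nhds hd) ⟨d + 1, by linarith⟩
    exact ⟨(d + l) / 2, by linarith, hlS ⟨by linarith, by linarith⟩⟩
  have hcon : ConcaveOn ℝ S fun x => φ x + min 0 (d - x) := by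
    refine hφ.add (((concaveOn_const 0 hφ.1).inf (concaveOn_affine hφ.1 d (-1))).congr
      fun y _ => ?_)
    simp only [Pi.inf_apply]
    congr 1
    ring
  have := hG.lower hφ (C := 1 + |d|) (by positivity) hcon
    (fun y _ => by linarith [min_le_left 0 (d - y)]) (fun y _ => ?_) (fun y hy => ?_) x hx
  · rcases this with h | h
    · exact (hpos x hx hxd).ne' h
    · rw [min_eq_right (by linarith)] at h
      linarith
  · rcases min_choice 0 (d - y) with h | h <;> rw [h]
    · have : 0 ≤ (1 + |d|) * (1 + |y|) := by positivity
      linarith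
    · nlinarith [neg_le_abs d, le_abs_self y, abs_nonneg d, abs_nonneg y,
        mul_nonneg (abs_nonneg d) (abs_nonneg y)]
  · rcases le_or_gt y d with h | h
    · exact Or.inr (by rw [min_eq_left (by linarith)]; ring)
    · exact Or.inl (hpos y hy h).le

lemma IsCritical.exists_nonpos_left (hG : IsCritical S φ G) (hS : IsOpen S)
    (hφ : ConcaveOn ℝ S φ) {d : ℝ} (hd : d ∈ S) : ∃ x ∈ S, x < d ∧ G x ≤ 0 := by
  by_contra! hpos
  obtain ⟨x, hxd, hx⟩ : ∃ x, x < d ∧ x ∈ S := by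
    obtain ⟨l, hl, hlS⟩ := exists_Ioc_subset_of_mem_nhds (hS.mem_nhds hd) ⟨d - 1, by linarith⟩
    exact ⟨(d + l) / 2, by linarith, hlS ⟨by linarith, by linarith⟩⟩
  have hcon : ConcaveOn ℝ S fun x => φ x + min 0 (x - d) := by
    refine hφ.add (((concaveOn_const 0 hφ.1).inf (concaveOn_affine hφ.1 (-d) 1)).congr
      fun y _ => ?_)
    simp only [Pi.inf_apply]
    congr 1
    ring
  have := hG.lower hφ (C := 1 + |d|) (by positivity) hcon
    (fun y _ => by linarith [min_le_left 0 (y - d)]) (fun y _ => ?_) (fun y hy => ?_) x hx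
  · rcases this with h | h
    · exact (hpos x hx hxd).ne' h
    · rw [min_eq_right (by linarith)] at h
      linarith
  · rcases min_choice 0 (y - d) with h | h <;> rw [h]
    · have : 0 ≤ (1 + |d|) * (1 + |y|) := by positivity
      linarith
    · nlinarith [le_abs_self d, neg_le_abs y, abs_nonneg d, abs_nonneg y,
        mul_nonneg (abs_nonneg d) (abs_nonneg y)]
  · rcases le_or_gt d y with h | h
    · exact Or.inr (by rw [min_eq_left (by linarith)]; ring)
    · exact Or.inl (hpos y hy h).le

lemma IsCritical.bddAbove (hG : IsCritical S φ G) (hS : IsOpen S) (hφ : ConcaveOn ℝ S φ) {A : ℝ}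
    (hA : ∀ x, A ≤ x → x - A ≤ G x - G A) : BddAbove S := by
  by_contra hb
  rw [not_bddAbove_iff] at hb
  obtain ⟨d, hd, hAd⟩ := hb (A + |G A|)
  obtain ⟨x, hx, hdx, hGx⟩ := hG.exists_nonpos_right hS hφ hd
  have := hA x (by linarith [abs_nonneg (G A)])
  linarith [neg_le_abs (G A)]

lemma IsCritical.bddBelow (hG : IsCritical S φ G) (hS : IsOpen S) (hφ : ConcaveOn ℝ S φ) {A : ℝ}
    (hA : ∀ x, x ≤ A → A - x ≤ G x - G A) : BddBelow S := by
  by_contra hb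
  rw [not_bddBelow_iff] at hb
  obtain ⟨d, hd, hAd⟩ := hb (A - |G A|)
  obtain ⟨x, hx, hdx, hGx⟩ := hG.exists_nonpos_left hS hφ hd
  have := hA x (by linarith [abs_nonneg (G A)])
  linarith [neg_le_abs (G A)]

end IsCritical

lemma IsOpen.eq_Ioo_of_convex {S : Set ℝ} (hS : IsOpen S) (hc : Convex ℝ S) (hne : S.Nonempty)
    (hb : BddBelow S) (ha : BddAbove S) : ∃ a b, a < b ∧ S = Ioo a b := by
  have hsub : S ⊆ Ioo (sInf S) (sSup S) := by
    have := interior_mono (subset_Icc_csInf_csSup hb ha)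
    rwa [interior_Icc, hS.interior_eq] at this
  obtain ⟨x, hx⟩ := hne
  exact ⟨sInf S, sSup S, (hsub hx).1.trans (hsub hx).2, hsub.antisymm
    ((IsConnected.Ioo_csInf_csSup_subset ⟨⟨x, hx⟩, hc.isPreconnected⟩ hb ha))⟩

section Interval

variable {a b : ℝ} {φ G : ℝ → ℝ}

/-- Where `G > 0` the critical log-density is affine. -/
lemma IsCritical.affine_of_pos (hG : IsCritical (Ioo a b) φ G) (hφ : ConcaveOn ℝ (Ioo a b) φ)
    {p r : ℝ} (hap : a ≤ p) (hpr : p < r) (hrb : r ≤ b) (hpos : ∀ x ∈ Ioo p r, 0 < G x) :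
    ∃ α β : ℝ, ∀ x ∈ Ioo p r, φ x = α + β * x := by
  have hap' : a < p := by
    refine hap.lt_of_ne fun h => ?_
    subst h
    obtain ⟨x, hx, hxd, hGx⟩ := hG.exists_nonpos_left isOpen_Ioo hφ (d := (a + r) / 2)
      ⟨by linarith, by linarith⟩
    exact hGx.not_gt (hpos x ⟨hx.1, by linarith⟩)
  have hrb' : r < b := by
    refine hrb.lt_of_ne fun h => ?_
    subst h
    obtain ⟨x, hx, hxd, hGx⟩ := hG.exists_nonpos_right isOpen_Ioo hφ (d := (p + r) / 2)
      ⟨by linarith, by linarith⟩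
    exact hGx.not_gt (hpos x ⟨by linarith, hx.2⟩)
  have hpS : p ∈ Ioo a b := ⟨hap', hpr.trans hrb'⟩
  have hrS : r ∈ Ioo a b := ⟨hap'.trans hpr, hrb'⟩
  have hd : 0 < r - p := sub_pos.2 hpr
  set β := (φ r - φ p) / (r - p) with hβ
  have hβr : β * (r - p) = φ r - φ p := div_mul_cancel₀ _ hd.ne'
  set α := φ p - β * p with hα
  have hout : ∀ x ∈ Ioo a b, x ∉ Ioo p r → φ x ≤ α + β * x := by
    intro x hx hxpr
    rcases le_or_gt x p with h | h
    · rcases h.eq_or_lt with rfl | h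
      · linarith
      have := hφ.slope_anti_adjacent hx hrS h hpr
      rw [← hβ, le_div_iff₀ (by linarith)] at this
      linarith
    · have hrx : r ≤ x := not_lt.1 fun h' => hxpr ⟨h, h'⟩
      rcases hrx.eq_or_lt with rfl | h'
      · linarith
      have := hφ.slope_anti_adjacent hpS hx hpr h'
      rw [← hβ, div_le_iff₀ (by linarith)] at this
      linarith
  obtain ⟨m, hm⟩ := hφ.exists_supergradient isOpen_Ioo hpS
  have hmin : ConcaveOn ℝ (Ioo a b) fun x => min (φ x) (α + β * x) :=
    hφ.inf (concaveOn_affine hφ.1 α β)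
  have hkey := hG.lower hφ (C := |β - m| * (1 + |p|)) (by positivity) hmin
    (fun x _ => min_le_left _ _) (fun x hx => ?_) fun x hx => ?_
  · refine ⟨α, β, fun x hx => ?_⟩
    have hxS : x ∈ Ioo a b := ⟨hap'.trans hx.1, hx.2.trans hrb'⟩
    have h1 : φ x ≤ α + β * x := by
      rcases hkey x hxS with h | h
      · exact absurd h (hpos x hx).ne'
      · exact min_eq_left_iff.1 h
    have h2 := hφ.slope_anti_adjacent hpS hrS hx.1 hx.2
    rw [div_le_div_iff₀ (by linarith [hx.2]) (by linarith [hx.1])] at h2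
    have h3 : 0 ≤ (r - p) * (φ x - (α + β * x)) := by
      have hp : φ p = α + β * p := by rw [hα]; ring
      have hr : φ r = α + β * r := by linarith
      rw [hp, hr] at h2
      linarith
    exact le_antisymm h1 (by linarith [nonneg_of_mul_nonneg_right h3 hd])
  · rcases min_choice (φ x) (α + β * x) with h | h <;> rw [h]
    · rw [sub_self]
      positivity
    · have h1 := hm x hx
      have h2 : φ x - (α + β * x) ≤ |β - m| * |p - x| := by
        rw [← abs_mul]
        refine le_trans ?_ (le_abs_self _)
        rw [hα]
        linarith
      refine h2.trans ?_
      rw [mul_assoc]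
      refine mul_le_mul_of_nonneg_left ?_ (abs_nonneg _)
      have := abs_sub p x
      nlinarith [mul_nonneg (abs_nonneg p) (abs_nonneg x)]
  · by_cases hx' : x ∈ Ioo p r
    · exact Or.inl (hpos x hx').le
    · exact Or.inr (min_eq_left (hout x hx hx'))

end Interval

section Glue

variable {S : Set ℝ} {φ : ℝ → ℝ} {c : ℝ}

lemma ConcaveOn.comp_min_right (hφ : ConcaveOn ℝ S φ) (hc : c ∈ S)
    (hmax : ∀ x ∈ S, φ x ≤ φ c) : ConcaveOn ℝ S fun x => φ (min x c) := by
  have hmem : ∀ x ∈ S, min x c ∈ S := fun x hx => by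
    rcases min_choice x c with h | h <;> rwa [h]
  refine ⟨hφ.1, fun x hx y hy s t hs ht hst => ?_⟩
  have hz := hφ.1 (hmem x hx) (hmem y hy) hs ht hst
  refine (hφ.2 (hmem x hx) (hmem y hy) hs ht hst).trans ?_
  refine (le_min le_rfl (hmax _ hz)).trans (hφ.min_le_of_mem_Icc hz hc ⟨?_, min_le_right _ _⟩)
  simp only [smul_eq_mul]
  refine le_min ?_ ?_
  · gcongr <;> exact min_le_left _ _
  · calc s * min x c + t * min y c ≤ s * c + t * c := by
          gcongr <;> exact min_le_right _ _
      _ = c := by rw [← add_mul, hst, one_mul]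

lemma ConcaveOn.comp_max_right (hφ : ConcaveOn ℝ S φ) (hc : c ∈ S)
    (hmax : ∀ x ∈ S, φ x ≤ φ c) : ConcaveOn ℝ S fun x => φ (max x c) := by
  have hmem : ∀ x ∈ S, max x c ∈ S := fun x hx => by
    rcases max_choice x c with h | h <;> rwa [h]
  refine ⟨hφ.1, fun x hx y hy s t hs ht hst => ?_⟩
  have hz := hφ.1 (hmem x hx) (hmem y hy) hs ht hst
  refine (hφ.2 (hmem x hx) (hmem y hy) hs ht hst).trans ?_
  refine (le_min (hmax _ hz) le_rfl).trans (hφ.min_le_of_mem_Icc hc hz ⟨le_max_right _ _, ?_⟩)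
  simp only [smul_eq_mul]
  refine max_le ?_ ?_
  · gcongr <;> exact le_max_left _ _
  · calc c = s * c + t * c := by rw [← add_mul, hst, one_mul]
      _ ≤ s * max x c + t * max y c := by
          gcongr <;> exact le_max_right _ _

/-- A concave function can be extended to the right of `c` by a supporting line. -/
lemma ConcaveOn.exists_extend_right (hS : IsOpen S) (hφ : ConcaveOn ℝ S φ) (hc : c ∈ S) :
    ∃ (h : ℝ → ℝ) (α β : ℝ), ConcaveOn ℝ S h ∧ (∀ x ∈ S, φ x ≤ h x) ∧ (∀ x ≤ c, h x = φ x) ∧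
      ∀ x, c ≤ x → h x = α + β * x := by
  obtain ⟨m, hm⟩ := hφ.exists_supergradient hS hc
  have hφ' : ConcaveOn ℝ S fun x => φ x + (0 + -m * x) := hφ.add (concaveOn_affine hφ.1 0 (-m))
  have hcon := (hφ'.comp_min_right hc fun x hx => by linarith [hm x hx]).add
    (concaveOn_affine hφ.1 0 m)
  refine ⟨_, φ c - m * c, m, hcon, fun x hx => ?_, fun x hx => ?_, fun x hx => ?_⟩ <;>
    simp only [Pi.add_apply]
  · rcases le_total x c with h | h
    · rw [min_eq_left h]
      linarith
    · rw [min_eq_right h]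
      linarith [hm x hx]
  · rw [min_eq_left hx]
    ring
  · rw [min_eq_right hx]
    ring

/-- A concave function can be extended to the left of `c` by a supporting line. -/
lemma ConcaveOn.exists_extend_left (hS : IsOpen S) (hφ : ConcaveOn ℝ S φ) (hc : c ∈ S) :
    ∃ (h : ℝ → ℝ) (α β : ℝ), ConcaveOn ℝ S h ∧ (∀ x ∈ S, φ x ≤ h x) ∧ (∀ x, c ≤ x → h x = φ x) ∧
      ∀ x ≤ c, h x = α + β * x := by
  obtain ⟨m, hm⟩ := hφ.exists_supergradient hS hc
  have hφ' : ConcaveOn ℝ S fun x => φ x + (0 + -m * x) := hφ.add (concaveOn_affine hφ.1 0 (-m))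
  have hcon := (hφ'.comp_max_right hc fun x hx => by linarith [hm x hx]).add
    (concaveOn_affine hφ.1 0 m)
  refine ⟨_, φ c - m * c, m, hcon, fun x hx => ?_, fun x hx => ?_, fun x hx => ?_⟩ <;>
    simp only [Pi.add_apply]
  · rcases le_total x c with h | h
    · rw [max_eq_right h]
      linarith [hm x hx]
    · rw [max_eq_left h]
      linarith
  · rw [max_eq_left hx]
    ring
  · rw [max_eq_right hx]
    ring

end Glue

lemma pos_or_neg_of_ne_zero {G : ℝ → ℝ} {p r : ℝ} (hG : ContinuousOn G (Ioo p r))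
    (hne : ∀ x ∈ Ioo p r, G x ≠ 0) :
    (∀ x ∈ Ioo p r, 0 < G x) ∨ ∀ x ∈ Ioo p r, G x < 0 := by
  by_contra! h
  obtain ⟨⟨x, hx, hGx⟩, y, hy, hGy⟩ := h
  obtain ⟨z, hz, hz0⟩ := isPreconnected_Ioo.intermediate_value hx hy hG ⟨hGx, hGy⟩
  exact hne z hz hz0

/-- `φ` is affine on each open piece of some finite subdivision of `[a, b]`. -/
def PiecewiseAffine (φ : ℝ → ℝ) (a b : ℝ) : Prop :=
  ∃ (K : ℕ) (t : ℕ → ℝ), 0 < K ∧ t 0 = a ∧ t K = b ∧ (∀ i < K, t i < t (i + 1)) ∧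
    ∀ i < K, ∃ α β : ℝ, ∀ y ∈ Ioo (t i) (t (i + 1)), φ y = α + β * y

namespace PiecewiseAffine

variable {φ : ℝ → ℝ} {a b c : ℝ}

lemma of_affine (hab : a < b) {α β : ℝ} (h : ∀ y ∈ Ioo a b, φ y = α + β * y) :
    PiecewiseAffine φ a b := by
  refine ⟨1, fun i => if i = 0 then a else b, one_pos, by simp, by simp, ?_, ?_⟩
  · simpa using hab
  · intro i hi
    obtain rfl : i = 0 := by omega
    exact ⟨α, β, by simpa using h⟩

lemma trans (hac : PiecewiseAffine φ a c) (hcb : PiecewiseAffine φ c b) :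
    PiecewiseAffine φ a b := by
  obtain ⟨K, t, hK, ht0, htK, hlt, haff⟩ := hac
  obtain ⟨L, s, hL, hs0, hsL, hlt', haff'⟩ := hcb
  set w : ℕ → ℝ := fun i => if i < K then t i else s (i - K) with hw
  have hw1 : ∀ i ≤ K, w i = t i := fun i hi => by
    rcases hi.lt_or_eq with h | rfl
    · simp [hw, h]
    · simp [hw, hs0, htK]
  have hw2 : ∀ i, K ≤ i → w i = s (i - K) := fun i hi => by simp [hw, hi.not_gt]
  have hstep : ∀ i < K + L, (i < K ∧ w i = t i ∧ w (i + 1) = t (i + 1)) ∨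
      (i - K < L ∧ w i = s (i - K) ∧ w (i + 1) = s (i - K + 1)) := fun i hi => by
    rcases lt_or_ge i K with h | h
    · exact Or.inl ⟨h, hw1 i h.le, hw1 (i + 1) h⟩
    · refine Or.inr ⟨by omega, hw2 i h, ?_⟩
      rw [hw2 (i + 1) (by omega), Nat.sub_add_comm h]
  refine ⟨K + L, w, by omega, by rw [hw1 0 (by omega), ht0],
    by rw [hw2 _ (by omega), Nat.add_sub_cancel_left, hsL], fun i hi => ?_, fun i hi => ?_⟩
  · rcases hstep i hi with ⟨h, h1, h2⟩ | ⟨h, h1, h2⟩ <;> rw [h1, h2]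
    exacts [hlt i h, hlt' _ h]
  · rcases hstep i hi with ⟨h, h1, h2⟩ | ⟨h, h1, h2⟩ <;> rw [h1, h2]
    exacts [haff i h, haff' _ h]

lemma of_min (hab : a < b) {α β γ δ : ℝ} (h : ∀ y ∈ Ioo a b, φ y = min (α + β * y) (γ + δ * y)) :
    PiecewiseAffine φ a b := by
  set D : ℝ → ℝ := fun y => (α + β * y) - (γ + δ * y) with hD
  have hsign : ∀ p r, a ≤ p → p < r → r ≤ b →
      (∀ x ∈ Ioo p r, 0 < D x) ∨ (∀ x ∈ Ioo p r, D x < 0) → PiecewiseAffine φ p r := by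
    intro p r hp hpr hr hs
    rcases hs with hs | hs
    · refine of_affine hpr (α := γ) (β := δ) fun y hy => ?_
      rw [h y ⟨by linarith [hy.1], by linarith [hy.2]⟩, min_eq_right (by linarith [hs y hy])]
    · refine of_affine hpr (α := α) (β := β) fun y hy => ?_
      rw [h y ⟨by linarith [hy.1], by linarith [hy.2]⟩, min_eq_left (by linarith [hs y hy])]
  have hDc : Continuous D := by fun_prop
  by_cases hz : ∃ z ∈ Ioo a b, D z = 0
  · obtain ⟨z, hz, hz0⟩ := hz
    by_cases hβ : β = δ
    · refine of_affine hab (α := α) (β := β) fun y hy => ?_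
      subst hβ
      rw [h y hy, min_eq_left (by linarith)]
    · have hne : ∀ y, y ≠ z → D y ≠ 0 := fun y hy h0 => by
        have : (β - δ) * (y - z) = 0 := by linarith
        rcases mul_eq_zero.1 this with h1 | h1
        · exact hβ (sub_eq_zero.1 h1)
        · exact hy (sub_eq_zero.1 h1)
      exact (hsign a z le_rfl hz.1 hz.2.le (pos_or_neg_of_ne_zero hDc.continuousOn
        fun x hx => hne x hx.2.ne)).trans (hsign z b hz.1.le hz.2 le_rfl
          (pos_or_neg_of_ne_zero hDc.continuousOn fun x hx => hne x hx.1.ne'))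
  · push Not at hz
    exact hsign a b le_rfl hab le_rfl (pos_or_neg_of_ne_zero hDc.continuousOn hz)

/-- Piecewise affinity may be checked on intervals avoiding a finite set. -/
lemma of_finset (Z : Finset ℝ) : ∀ a b : ℝ, a < b →
    (∀ p r, a ≤ p → p < r → r ≤ b → (∀ z ∈ Z, z ∉ Ioo p r) → PiecewiseAffine φ p r) →
    PiecewiseAffine φ a b := by
  induction Z using Finset.induction_on with
  | empty => exact fun a b hab h => h a b le_rfl hab le_rfl (by simp)
  | insert z Z _ ih =>
    intro a b hab h
    by_cases hz : z ∈ Ioo a b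
    · refine (ih a z hz.1 fun p r hp hpr hr hZ => ?_).trans
        (ih z b hz.2 fun p r hp hpr hr hZ => ?_)
      · refine h p r hp hpr (hr.trans hz.2.le) fun w hw => ?_
        rcases Finset.mem_insert.1 hw with rfl | hw
        · exact fun hw => hw.2.not_ge hr
        · exact hZ w hw
      · refine h p r (hz.1.le.trans hp) hpr hr fun w hw => ?_
        rcases Finset.mem_insert.1 hw with rfl | hw
        · exact fun hw => hw.1.not_ge hp
        · exact hZ w hw
    · refine ih a b hab fun p r hp hpr hr hZ => h p r hp hpr hr fun w hw => ?_
      rcases Finset.mem_insert.1 hw with rfl | hw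
      · exact fun hw => hz ⟨hp.trans_lt hw.1, hw.2.trans_le hr⟩
      · exact hZ w hw

end PiecewiseAffine

section Interval

variable {a b : ℝ} {φ G : ℝ → ℝ}

/-- Where `G < 0` the critical log-density has at most two affine pieces. -/
lemma IsCritical.piecewiseAffine_of_neg (hG : IsCritical (Ioo a b) φ G)
    (hφ : ConcaveOn ℝ (Ioo a b) φ) {p r : ℝ} (hap : a ≤ p) (hpr : p < r) (hrb : r ≤ b)
    (hneg : ∀ x ∈ Ioo p r, G x < 0) : PiecewiseAffine φ p r := by
  have hsub : ∀ x ∈ Ioo p r, x ∈ Ioo a b := fun x hx => ⟨hap.trans_lt hx.1, hx.2.trans_le hrb⟩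
  rcases hap.eq_or_lt with rfl | hap' <;> rcases hrb.eq_or_lt with rfl | hrb'
  · obtain ⟨x, hx⟩ := nonempty_Ioo.2 hpr
    have := hG.raise hφ (h := fun x => φ x + 1) (hφ.add (concaveOn_const 1 hφ.1))
      (fun x _ => by linarith) (fun x hx => Or.inl (hneg x hx).le) x hx
    rcases this with h | h
    · exact absurd h (hneg x hx).ne
    · linarith
  · obtain ⟨h, α, β, hh, hle, heq, haff⟩ :=
      hφ.exists_extend_left isOpen_Ioo (c := r) ⟨hpr, hrb'⟩
    have hkey := hG.raise hφ hh hle fun x hx => (lt_or_ge x r).imp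
      (fun h => (hneg x ⟨hx.1, h⟩).le) (heq x)
    exact .of_affine hpr fun x hx => by
      rw [← (hkey x (hsub x hx)).resolve_left (hneg x hx).ne, haff x hx.2.le]
  · obtain ⟨h, α, β, hh, hle, heq, haff⟩ :=
      hφ.exists_extend_right isOpen_Ioo (c := p) ⟨hap', hpr⟩
    have hkey := hG.raise hφ hh hle fun x hx => (lt_or_ge p x).imp
      (fun h => (hneg x ⟨h, hx.2⟩).le) (heq x)
    exact .of_affine hpr fun x hx => by
      rw [← (hkey x (hsub x hx)).resolve_left (hneg x hx).ne, haff x hx.1.le]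
  · obtain ⟨h, α, β, hh, hle, heq, haff⟩ :=
      hφ.exists_extend_right isOpen_Ioo (c := p) ⟨hap', hpr.trans hrb'⟩
    obtain ⟨h', γ, δ, hh', hle', heq', haff'⟩ :=
      hφ.exists_extend_left isOpen_Ioo (c := r) ⟨hap'.trans hpr, hrb'⟩
    have hkey := hG.raise hφ (hh.inf hh') (fun x hx => le_min (hle x hx) (hle' x hx))
      fun x hx => ?_
    · refine .of_min (α := α) (β := β) (γ := γ) (δ := δ) hpr fun x hx => ?_
      rw [← (hkey x (hsub x hx)).resolve_left (hneg x hx).ne, ← haff x hx.1.le, ← haff' x hx.2.le]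
      rfl
    · rcases le_or_gt x p with h1 | h1
      · refine Or.inr ?_
        rw [Pi.inf_apply, heq x h1]
        exact min_eq_left (hle' x hx)
      rcases le_or_gt r x with h2 | h2
      · refine Or.inr ?_
        rw [Pi.inf_apply, heq' x h2]
        exact min_eq_right (hle x hx)
      · exact Or.inl (hneg x ⟨h1, h2⟩).le

lemma IsCritical.piecewiseAffine (hG : IsCritical (Ioo a b) φ G) (hφ : ConcaveOn ℝ (Ioo a b) φ)
    (hab : a < b) (hGc : Continuous G) (hfin : {x | G x = 0}.Finite) :
    PiecewiseAffine φ a b := by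
  refine .of_finset hfin.toFinset a b hab fun p r hap hpr hrb hZ => ?_
  rcases pos_or_neg_of_ne_zero hGc.continuousOn
    (fun x hx h0 => hZ x (hfin.mem_toFinset.2 h0) hx) with h | h
  · obtain ⟨α, β, hφ'⟩ := hG.affine_of_pos hφ hap hpr hrb h
    exact .of_affine hpr hφ'
  · exact hG.piecewiseAffine_of_neg hφ hap hpr hrb h

end Interval

section potential

variable {q : ℝ → ℝ}

lemma finite_potential_eq (hq : Monotone q) (hfin : (range q).Finite) (ν : Measure ℝ)
    [IsProbabilityMeasure ν] (x₀ c : ℝ) : {x | potential q ν x₀ x - c = 0}.Finite := by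
  have hsub : {x | potential q ν x₀ x - c = 0} ⊆
      ⋃ v ∈ range q, {x | potential q ν x₀ x = c ∧ q (ν.real (Iic x)) = v} := fun x hx => by
    simp only [mem_iUnion]
    exact ⟨_, mem_range_self _, sub_eq_zero.1 hx, rfl⟩
  refine (hfin.biUnion fun v _ => ?_).subset hsub
  set T := {x | potential q ν x₀ x = c ∧ q (ν.real (Iic x)) = v} with hT
  have hmono := monotone_comp_measureReal_Iic hq ν
  have hpair : ∀ x ∈ T, ∀ y ∈ T, x ≤ y → x = y ∨ x + y = 2 * v := by
    intro x hx y hy hxy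
    have h1 : ∫ s in x..y, (s - q (ν.real (Iic s))) = ∫ s in x..y, (s - v) := by
      refine intervalIntegral.integral_congr fun s hs => ?_
      rw [uIcc_of_le hxy] at hs
      have : q (ν.real (Iic s)) = v :=
        le_antisymm ((hmono hs.2).trans hy.2.le) (hx.2.ge.trans (hmono hs.1))
      simp only [this]
    rw [← potential_sub hq ν x₀, hx.1, hy.1, sub_self, intervalIntegral.integral_sub
      intervalIntegral.intervalIntegrable_id intervalIntegrable_const, integral_id,
      intervalIntegral.integral_const, smul_eq_mul] at h1
    have h2 : (y - x) * (x + y - 2 * v) = 0 := by linarith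
    rcases mul_eq_zero.1 h2 with h | h
    · exact Or.inl (by linarith)
    · exact Or.inr (by linarith)
  rcases T.eq_empty_or_nonempty with h | ⟨x, hx⟩
  · simp [h]
  · refine (toFinite {x, 2 * v - x}).subset fun y hy => ?_
    rcases le_total x y with h | h
    · rcases hpair x hx y hy h with h | h
      · exact Or.inl h.symm
      · exact Or.inr (by simp; linarith)
    · rcases hpair y hy x hx h with h | h
      · exact Or.inl h
      · exact Or.inr (by simp; linarith)

lemma potential_growth_right {M : ℝ} (hq : Monotone q) (hM : ∀ u, |q u| ≤ M) (ν : Measure ℝ)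
    [IsProbabilityMeasure ν] (x₀ : ℝ) {x : ℝ} (hx : M + 1 ≤ x) :
    x - (M + 1) ≤ potential q ν x₀ x - potential q ν x₀ (M + 1) := by
  rw [potential_sub hq ν]
  have := intervalIntegral.integral_mono_on hx (intervalIntegrable_const (c := (1 : ℝ)))
    (intervalIntegrable_potential hq ν _ _)
    (fun y hy => by linarith [hy.1, (abs_le.1 (hM (ν.real (Iic y)))).2])
  simpa using this

lemma potential_growth_left {M : ℝ} (hq : Monotone q) (hM : ∀ u, |q u| ≤ M) (ν : Measure ℝ)
    [IsProbabilityMeasure ν] (x₀ : ℝ) {x : ℝ} (hx : x ≤ -(M + 1)) :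
    -(M + 1) - x ≤ potential q ν x₀ x - potential q ν x₀ (-(M + 1)) := by
  have := intervalIntegral.integral_mono_on hx (intervalIntegrable_potential hq ν _ _)
    (intervalIntegrable_const (c := (-1 : ℝ)))
    (fun y hy => by linarith [hy.2, (abs_le.1 (hM (ν.real (Iic y)))).1])
  rw [← potential_sub hq ν x₀, intervalIntegral.integral_const, smul_eq_mul] at this
  linarith

end potential

/-- The log-density of a log-concave projection of a measure with finitely many atoms is
piecewise affine. -/
theorem exists_piecewiseAffine_of_minimizer {S : Set ℝ} {φ q : ℝ → ℝ} (hq : Monotone q)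
    (hfin : (range q).Finite)
    (hS : IsOpen S) (hφ : ConcaveOn ℝ S φ) [IsProbabilityMeasure (logMeasure S φ)]
    (hmin : ∀ ν ∈ Flc, ∫ u in Ioo (0 : ℝ) 1, (quantile (logMeasure S φ) u - q u) ^ 2 ≤
      ∫ u in Ioo (0 : ℝ) 1, (quantile ν u - q u) ^ 2) :
    ∃ a b, a < b ∧ S = Ioo a b ∧ PiecewiseAffine φ a b := by
  obtain ⟨M, hM⟩ := hfin.isBounded.exists_norm_le
  replace hM : ∀ u, |q u| ≤ M := fun u => hM _ (mem_range_self u)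
  have hne : S.Nonempty := nonempty_of_isProbabilityMeasure (φ := φ)
  obtain ⟨x₀, hx₀⟩ := id hne
  have hG := isCritical_potential hq hM hS hφ hmin hx₀
  obtain ⟨a, b, hab, rfl⟩ := hS.eq_Ioo_of_convex hφ.1 hne
    (hG.bddBelow hS hφ (A := -(M + 1)) fun x hx => by
      linarith [potential_growth_left hq hM (logMeasure S φ) x₀ hx])
    (hG.bddAbove hS hφ (A := M + 1) fun x hx => by
      linarith [potential_growth_right hq hM (logMeasure S φ) x₀ hx])
  exact ⟨a, b, hab, rfl, hG.piecewiseAffine hφ hab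
    ((continuous_potential hq _ _).sub continuous_const) (finite_potential_eq hq hfin _ _ _)⟩

lemma quantile_dirac (c : ℝ) {u : ℝ} (hu : u ∈ Ioo (0 : ℝ) 1) :
    quantile (Measure.dirac c) u = c := by
  refine eq_of_forall_ge_iff fun x => ?_
  rw [quantile_le_iff _ hu, measureReal_def, Measure.dirac_apply' _ measurableSet_Iic]
  by_cases h : c ≤ x
  · simp [h, hu.2.le]
  · simp [h, hu.1]

lemma eq_dirac_of_quantile_ae_eq (ν : Measure ℝ) [IsProbabilityMeasure ν] {c : ℝ}
    (h : ∀ᵐ u ∂volume.restrict (Ioo (0 : ℝ) 1), quantile ν u = c) : ν = Measure.dirac c := by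
  rw [← map_quantile ν, Measure.map_congr (g := fun _ => c) h, Measure.map_const, measure_univ,
    one_smul]

/-- The uniform distribution on `(s, s + ε)`, described by its quantile function. -/
lemma exists_uniform (s : ℝ) {ε : ℝ} (hε : 0 < ε) :
    ∃ σ ∈ Flc, ∀ u ∈ Ioo (0 : ℝ) 1, quantile σ u = s + ε * u := by
  set S := Ioo s (s + ε) with hSdef
  set φ : ℝ → ℝ := fun _ => -Real.log ε with hφdef
  have hφ : ConcaveOn ℝ S φ := concaveOn_const _ (convex_Ioo _ _)
  have hd : logDensity S φ = S.indicator fun _ => ε⁻¹ := by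
    unfold logDensity
    congr 1
    ext y
    simp [hφdef, Real.exp_neg, Real.exp_log hε]
  have hvol : volume.real S = ε := by
    rw [Real.volume_real_Ioo_of_le (by linarith)]
    ring
  have hi : Integrable (logDensity S φ) := by
    rw [hd, integrable_indicator_iff measurableSet_Ioo]
    exact integrableOn_const measure_Ioo_lt_top.ne
  have hA : ∀ A, MeasurableSet A → ∫ x in A, logDensity S φ x = ε⁻¹ * volume.real (A ∩ S) := by
    intro A _
    rw [hd, setIntegral_indicator measurableSet_Ioo, setIntegral_const, smul_eq_mul, mul_comm]
  have h1 : ∫ x, logDensity S φ x = 1 := by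
    rw [← setIntegral_univ, hA _ MeasurableSet.univ, univ_inter, hvol, inv_mul_cancel₀ hε.ne']
  have := isProbabilityMeasure_logMeasure hi h1
  refine ⟨logMeasure S φ, logMeasure_mem_Flc hφ, fun u hu => ?_⟩
  have hF := measureReal_Iic_quantile (logMeasure S φ) hu
  rw [measureReal_logMeasure isOpen_Ioo hφ measurableSet_Iic, hA _ measurableSet_Iic] at hF
  set x := quantile (logMeasure S φ) u
  rcases le_or_gt x s with hx | hx
  · have : Iic x ∩ S = ∅ := by
      ext y
      simp only [hSdef, mem_inter_iff, mem_Iic, mem_Ioo, mem_empty_iff_false, iff_false]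
      intro h
      linarith [h.1, h.2.1]
    rw [this, measureReal_empty, mul_zero] at hF
    linarith [hu.1]
  rcases lt_or_ge x (s + ε) with hx' | hx'
  · have : Iic x ∩ S = Ioc s x := by
      ext y
      simp only [hSdef, mem_inter_iff, mem_Iic, mem_Ioo, mem_Ioc]
      constructor
      · exact fun h => ⟨h.2.1, h.1⟩
      · exact fun h => ⟨h.2, h.1, by linarith [h.2]⟩
    rw [this, Real.volume_real_Ioc_of_le hx.le, inv_mul_eq_iff_eq_mul₀ hε.ne'] at hF
    linarith
  · have : Iic x ∩ S = S := inter_eq_right.2 fun y hy => hy.2.le.trans hx'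
    rw [this, hvol, inv_mul_cancel₀ hε.ne'] at hF
    linarith [hu.2]

/-- A point mass is the only log-concave minimizer of the distance to itself. -/
lemma eq_dirac_of_minimizer {μ : Measure ℝ} (hμ : μ ∈ Flc) {c : ℝ}
    (hmin : Wdist 2 μ (Measure.dirac c) ≤ Wdist 2 (Measure.dirac c) (Measure.dirac c)) :
    μ = Measure.dirac c := by
  have := hμ.1
  rw [Wdist_two_le_iff] at hmin
  have hcongr : ∀ ν : Measure ℝ,
      ∫ u in Ioo (0 : ℝ) 1, (quantile ν u - quantile (Measure.dirac c) u) ^ 2 =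
        ∫ u in Ioo (0 : ℝ) 1, (quantile ν u - c) ^ 2 := fun ν =>
    setIntegral_congr_fun measurableSet_Ioo fun u hu => by simp only [quantile_dirac c hu]
  have hzero : ∫ u in Ioo (0 : ℝ) 1, (quantile (Measure.dirac c) u - c) ^ 2 = 0 := by
    rw [setIntegral_congr_fun (g := fun _ => 0) measurableSet_Ioo fun u hu => by
      simp [quantile_dirac c hu], integral_zero]
  rw [hcongr, hcongr, hzero] at hmin
  have hsq : Integrable (fun x => (1 + |x|) ^ 2) μ := by
    by_cases hd : ∃ c', μ = Measure.dirac c'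
    · obtain ⟨c', rfl⟩ := hd
      exact integrable_dirac (by simp)
    · push Not at hd
      obtain ⟨S, φ, hS, hφ, rfl⟩ := exists_eq_logMeasure hμ hd
      exact integrable_sq_logMeasure hS hφ (integrable_logDensity hS hφ)
  have hi := integrableOn_quantile_sub_sq (monotone_const (c := c)) (fun _ => le_rfl) μ hsq
  have h0 := (setIntegral_eq_zero_iff_of_nonneg_ae (Eventually.of_forall fun u => sq_nonneg _)
    hi).1 (le_antisymm hmin (integral_nonneg fun _ => sq_nonneg _))
  refine eq_dirac_of_quantile_ae_eq μ (h0.mono fun u hu => ?_)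
  simpa [sub_eq_zero] using hu

/-- A point mass is not the log-concave projection of any other compactly supported measure. -/
lemma quantile_ae_eq_const_of_minimizer {q : ℝ → ℝ} (hq : Monotone q) {M : ℝ}
    (hM : ∀ u, |q u| ≤ M) {c : ℝ}
    (hmin : ∀ ν ∈ Flc, ∫ u in Ioo (0 : ℝ) 1, (c - q u) ^ 2 ≤
      ∫ u in Ioo (0 : ℝ) 1, (quantile ν u - q u) ^ 2) :
    ∀ᵐ u ∂volume.restrict (Ioo (0 : ℝ) 1), q u = q (1 / 2) := by
  set m := volume.restrict (Ioo (0 : ℝ) 1) with hm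
  have hbd : ∀ {g : ℝ → ℝ} (C : ℝ), Measurable g → (∀ u ∈ Ioo (0 : ℝ) 1, |g u| ≤ C) →
      Integrable g m := fun {g} C hg hgC =>
    Integrable.of_bound hg.aestronglyMeasurable C
      ((ae_restrict_iff' measurableSet_Ioo).2 (Eventually.of_forall hgC))
  have hqm := hq.measurable
  have hu1 : ∀ u ∈ Ioo (0 : ℝ) 1, |u - 1 / 2| ≤ 1 := fun u hu => by
    rw [abs_le]
    constructor <;> linarith [hu.1, hu.2]
  have hlin : Integrable (fun u : ℝ => u - 1 / 2) m := hbd 1 (by fun_prop) hu1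
  have hprod : ∀ c : ℝ, Integrable (fun u => (u - 1 / 2) * (c - q u)) m := fun c =>
    hbd (1 * (|c| + M)) (by fun_prop) fun u hu => by
      rw [abs_mul]
      exact mul_le_mul (hu1 u hu) ((abs_sub _ _).trans (add_le_add le_rfl (hM u)))
        (abs_nonneg _) zero_le_one
  have hsq : Integrable (fun u : ℝ => (u - 1 / 2) ^ 2) m := hbd 1 (by fun_prop) fun u hu => by
    rw [abs_pow]
    exact pow_le_one₀ (abs_nonneg _) (hu1 u hu)
  have hcq : Integrable (fun u => (c - q u) ^ 2) m :=
    hbd ((|c| + M) ^ 2) (by fun_prop) fun u hu => by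
      rw [abs_pow]
      exact pow_le_pow_left₀ (abs_nonneg _) ((abs_sub _ _).trans (add_le_add le_rfl (hM u))) 2
  set I := ∫ u, (u - 1 / 2) * (c - q u) ∂m with hI
  set J := ∫ u, (u - 1 / 2) ^ 2 ∂m with hJ
  have hJ0 : 0 ≤ J := integral_nonneg fun _ => sq_nonneg _
  have hexp : ∀ ε > 0, 0 ≤ 2 * I + ε * J := by
    intro ε hε
    obtain ⟨σ, hσ, hσq⟩ := exists_uniform (c - ε / 2) hε
    have h1 := hmin σ hσ
    have h2 : ∫ u in Ioo (0 : ℝ) 1, (quantile σ u - q u) ^ 2 =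
        (∫ u, (c - q u) ^ 2 ∂m) + ε * (2 * I + ε * J) := by
      have hsum : Integrable (fun u => 2 * ((u - 1 / 2) * (c - q u)) + ε * (u - 1 / 2) ^ 2) m :=
        ((hprod c).const_mul 2).add (hsq.const_mul ε)
      rw [hI, hJ, ← integral_const_mul, ← integral_const_mul,
        ← integral_add ((hprod c).const_mul 2) (hsq.const_mul ε), ← integral_const_mul,
        ← integral_add hcq (hsum.const_mul ε)]
      refine setIntegral_congr_fun measurableSet_Ioo fun u hu => ?_
      simp only [hσq u hu]
      ring
    rw [h2] at h1
    exact nonneg_of_mul_nonneg_right (by linarith) hε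
  have hInn : 0 ≤ I := by
    by_contra! hlt
    have h1 := hexp (-I / (J + 1)) (div_pos (by linarith) (by linarith))
    have h2 : -I / (J + 1) * J ≤ -I := by
      rw [div_mul_eq_mul_div, div_le_iff₀ (by linarith)]
      nlinarith
    linarith
  have hlin0 : ∫ u, (u - 1 / 2) ∂m = 0 := by
    rw [hm, ← integral_Ioc_eq_integral_Ioo, ← intervalIntegral.integral_of_le zero_le_one,
      intervalIntegral.integral_sub intervalIntegral.intervalIntegrable_id
        intervalIntegrable_const, integral_id, intervalIntegral.integral_const]
    norm_num
  have hI' : ∫ u, (u - 1 / 2) * (q (1 / 2) - q u) ∂m = I := by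
    have : ∀ u, (u - 1 / 2) * (q (1 / 2) - q u) =
        (q (1 / 2) - c) * (u - 1 / 2) + (u - 1 / 2) * (c - q u) := fun u => by ring
    simp only [this]
    rw [integral_add (hlin.const_mul _) (hprod c), integral_const_mul, hlin0, mul_zero, zero_add]
  have hnn : ∀ u, 0 ≤ -((u - 1 / 2) * (q (1 / 2) - q u)) := fun u => by
    rcases le_total u (1 / 2) with h | h <;> nlinarith [hq h]
  have hz := (integral_eq_zero_iff_of_nonneg hnn (hprod (q (1 / 2))).neg).1 <| by
    refine le_antisymm ?_ (integral_nonneg hnn)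
    rw [integral_neg, hI']
    linarith
  have hne : ∀ᵐ u ∂m, u ≠ 1 / 2 := ae_restrict_of_ae (Measure.ae_ne volume _)
  filter_upwards [hz, hne] with u hu hu'
  rcases mul_eq_zero.1 (neg_eq_zero.1 hu) with h | h
  · exact absurd (sub_eq_zero.1 h) hu'
  · exact (sub_eq_zero.1 h).symm

/-- Theorem 4.7, structure of the log-concave Wasserstein projection
estimator. Let `μn = (1/n) Σ_{i<n} δ_{x_i}` and let `μhat` be the Wasserstein projection
of `μn` onto `F_lc`. If `μn` is a point mass then `μhat = μn`. Otherwise, `μhat` has a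
compactly supported density `f` which is piecewise log-affine with finitely many pieces:
`f` vanishes outside a compact interval `[a, b]` which is partitioned into finitely many
subintervals on each of which `f = exp(affine)`. -/
theorem wasserstein_projection_logConcave_piecewise_logaffine
    (n : ℕ) (hn : 0 < n) (x : ℕ → ℝ)
    (μn : MeasureTheory.Measure ℝ)
    (hμn : μn = (n : ENNReal)⁻¹ • ∑ i ∈ Finset.range n, MeasureTheory.Measure.dirac (x i))
    (μhat : MeasureTheory.Measure ℝ)
    (hμhatF : μhat ∈ Flc)
    (hμhatmin : ∀ ν ∈ Flc, Wdist 2 μhat μn ≤ Wdist 2 ν μn) :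
    ((∃ c : ℝ, μn = MeasureTheory.Measure.dirac c) → μhat = μn) ∧
    ((¬ ∃ c : ℝ, μn = MeasureTheory.Measure.dirac c) →
      ∃ f : ℝ → ℝ, (∀ y, 0 ≤ f y) ∧
        μhat = MeasureTheory.volume.withDensity (fun y => ENNReal.ofReal (f y)) ∧
        ∃ a b : ℝ, a < b ∧ (∀ y, y ∉ Set.Icc a b → f y = 0) ∧
          ∃ (K : ℕ) (t : ℕ → ℝ), 0 < K ∧ t 0 = a ∧ t K = b ∧
            (∀ i < K, t i < t (i + 1)) ∧
            (∀ i < K, ∃ α β : ℝ, ∀ y ∈ Set.Ioo (t i) (t (i + 1)),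
              f y = Real.exp (α + β * y))) := by
  constructor
  · rintro ⟨c, rfl⟩
    exact eq_dirac_of_minimizer hμhatF
      (hμhatmin _ ⟨Measure.dirac.isProbabilityMeasure, Or.inl ⟨c, rfl⟩⟩)
  intro hnd
  have hprob : IsProbabilityMeasure μn := hμn ▸ isProbabilityMeasure_empirical hn x
  obtain ⟨q, hq, hfin, hqμ⟩ := exists_monotone_eq_quantile_empirical hn x
  rw [← hμn] at hqμ
  obtain ⟨M, hM⟩ := hfin.isBounded.exists_norm_le
  replace hM : ∀ u, |q u| ≤ M := fun u => hM _ (mem_range_self u)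
  have hcongr : ∀ ν : Measure ℝ, ∫ u in Ioo (0 : ℝ) 1, (quantile ν u - quantile μn u) ^ 2 =
      ∫ u in Ioo (0 : ℝ) 1, (quantile ν u - q u) ^ 2 := fun ν =>
    setIntegral_congr_fun measurableSet_Ioo fun u hu => by simp only [hqμ u hu]
  have hmin : ∀ ν ∈ Flc, ∫ u in Ioo (0 : ℝ) 1, (quantile μhat u - q u) ^ 2 ≤
      ∫ u in Ioo (0 : ℝ) 1, (quantile ν u - q u) ^ 2 := fun ν hν => by
    rw [← hcongr, ← hcongr, ← Wdist_two_le_iff]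
    exact hμhatmin ν hν
  have hhat : ∀ c, μhat ≠ Measure.dirac c := by
    rintro c rfl
    have hdirac : ∫ u in Ioo (0 : ℝ) 1, (quantile (Measure.dirac c) u - q u) ^ 2 =
        ∫ u in Ioo (0 : ℝ) 1, (c - q u) ^ 2 :=
      setIntegral_congr_fun measurableSet_Ioo fun u hu => by simp only [quantile_dirac c hu]
    rw [hdirac] at hmin
    refine hnd ⟨q (1 / 2), eq_dirac_of_quantile_ae_eq μn ?_⟩
    filter_upwards [quantile_ae_eq_const_of_minimizer hq hM hmin,
      ae_restrict_mem measurableSet_Ioo] with u hu hu'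
    rw [hqμ u hu', hu]
  obtain ⟨S, φ, hS, hφ, rfl⟩ := exists_eq_logMeasure hμhatF hhat
  have := hμhatF.1
  obtain ⟨a, b, hab, rfl, K, t, hK, ht0, htK, hlt, haff⟩ :=
    exists_piecewiseAffine_of_minimizer hq hfin hS hφ hmin
  have hmono : MonotoneOn t (Iic K) := by
    refine monotoneOn_of_le_add_one ordConnected_Iic fun i _ _ hi => (hlt i ?_).le
    exact hi
  refine ⟨logDensity (Ioo a b) φ, logDensity_nonneg, rfl, a, b, hab,
    fun y hy => logDensity_of_notMem fun h => hy (Ioo_subset_Icc_self h),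
    K, t, hK, ht0, htK, hlt, fun i hi => ?_⟩
  obtain ⟨α, β, h⟩ := haff i hi
  refine ⟨α, β, fun y hy => ?_⟩
  have h0 := hmono (mem_Iic.2 (K.zero_le)) (mem_Iic.2 hi.le) (i.zero_le)
  have h1 : t (i + 1) ≤ t K := hmono (mem_Iic.2 hi) (mem_Iic.2 le_rfl) hi
  have hyab : y ∈ Ioo a b := ⟨by linarith [hy.1], by linarith [hy.2]⟩
  rw [logDensity_of_mem hyab, h y hy]
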